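/- Let V be an optimal computer and let T be a computable real with 0 < T < 1. Then the statistical mechanical entropy S_V(T) = (E_V(T) − F_V(T))/T is a well-defined real that is Chaitin T-random and T-compressible. -/

import Mathlib

open Filter Topology

/-- A set of finite binary strings is prefix-free if no string in it is a
proper prefix of another string in it. -/
def PrefixFree (S : Set (List Bool)) : Prop :=
  ∀ p ∈ S, ∀ q ∈ S, p <+: q → p = q

/-- A computer: a partial recursive function from finite binary strings to
finite binary strings whose domain is a nonempty prefix-free set. -/
structure Computer where
  f : List Bool →. List Bool
  partrec : Partrec f
  dom_nonempty : f.Dom.Nonempty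
  dom_prefixFree : PrefixFree f.Dom

/-- A computer `U` is optimal if for each computer `C` there is `d ∈ ℕ` such
that every `p ∈ Dom C` admits `q` with `U(q) = C(p)` and `|q| ≤ |p| + d`. -/
def Optimal (U : Computer) : Prop :=
  ∀ C : Computer, ∃ d : ℕ, ∀ p ∈ C.f.Dom,
    ∃ q : List Bool, U.f q = C.f p ∧ q.length ≤ p.length + d

/-- `H_C(s)`: the length of a shortest program for `C` printing `s`. -/
noncomputable def complexity (C : Computer) (s : List Bool) : ℕ :=
  sInf {n | ∃ p : List Bool, s ∈ C.f p ∧ p.length = n}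

/-- The `i`-th bit (for `i = 0, 1, 2, …`) of the base-two expansion of
`α - ⌊α⌋` with infinitely many zeros. -/
noncomputable def bitOf (α : ℝ) (i : ℕ) : Bool :=
  decide (⌊(α - ⌊α⌋) * 2 ^ (i + 1)⌋ % 2 = 1)

/-- `α↾n`: the first `n` bits of the base-two expansion of `α - ⌊α⌋`
with infinitely many zeros. -/
noncomputable def firstBits (α : ℝ) (n : ℕ) : List Bool :=
  (List.range n).map (bitOf α)

/-- A real `α` is computable if some total recursive `f : ℕ⁺ → ℚ` satisfies
`|α - f n| < 1/n` for all `n ≥ 1`. -/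
def ComputableReal (α : ℝ) : Prop :=
  ∃ f : ℕ → ℚ, Computable f ∧ ∀ n : ℕ, 0 < n → |α - (f n : ℝ)| < 1 / n

/-- `α` is weakly Chaitin `T`-random (w.r.t. the computer `U`). -/
def WeaklyChaitinTRandom (U : Computer) (T α : ℝ) : Prop :=
  ∃ c : ℕ, ∀ n : ℕ, 0 < n → T * n - c ≤ (complexity U (firstBits α n) : ℝ)

/-- `α` is Chaitin `T`-random (w.r.t. the computer `U`). -/
def ChaitinTRandom (U : Computer) (T α : ℝ) : Prop :=
  Tendsto (fun n : ℕ => (complexity U (firstBits α n) : ℝ) - T * n) atTop atTop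

/-- `α` is `T`-compressible (w.r.t. the computer `U`): `H(α↾n) ≤ Tn + o(n)`. -/
def TCompressible (U : Computer) (T α : ℝ) : Prop :=
  ∃ g : ℕ → ℝ, Tendsto (fun n : ℕ => g n / n) atTop (nhds 0) ∧
    ∀ n : ℕ, 0 < n → (complexity U (firstBits α n) : ℝ) ≤ T * n + g n

/-- The Boltzmann factor `2^(-|p|/T)` of a program `p`. -/
noncomputable def boltzmann (T : ℝ) (p : List Bool) : ℝ :=
  (2 : ℝ) ^ (-(p.length : ℝ) / T)

/-- Partition function `Z_C(T) = Σ_{p ∈ Dom C} 2^(-|p|/T)`. -/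
noncomputable def Zfun (C : Computer) (T : ℝ) : ℝ :=
  ∑' p : C.f.Dom, boltzmann T p.1

/-- Free energy `F_C(T) = -T log₂ Z_C(T)`. -/
noncomputable def Ffun (C : Computer) (T : ℝ) : ℝ :=
  -T * Real.logb 2 (Zfun C T)

/-- Energy `E_C(T) = Z_C(T)⁻¹ Σ_{p ∈ Dom C} |p| 2^(-|p|/T)`. -/
noncomputable def Efun (C : Computer) (T : ℝ) : ℝ :=
  (Zfun C T)⁻¹ * ∑' p : C.f.Dom, (p.1.length : ℝ) * boltzmann T p.1

/-- Statistical mechanical entropy `S_C(T) = (E_C(T) - F_C(T))/T`. -/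
noncomputable def Sfun (C : Computer) (T : ℝ) : ℝ :=
  (Efun C T - Ffun C T) / T

/-- `𝒵(V)`: the set of `T ∈ (0,1)` with `Z_V(T)` computable. -/
def setZ (V : Computer) : Set ℝ := {T | T ∈ Set.Ioo 0 1 ∧ ComputableReal (Zfun V T)}

/-- `ℱ(V)`: the set of `T ∈ (0,1)` with `F_V(T)` computable. -/
def setF (V : Computer) : Set ℝ := {T | T ∈ Set.Ioo 0 1 ∧ ComputableReal (Ffun V T)}

/-- `ℰ(V)`: the set of `T ∈ (0,1)` with `E_V(T)` computable. -/
def setE (V : Computer) : Set ℝ := {T | T ∈ Set.Ioo 0 1 ∧ ComputableReal (Efun V T)}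

/-- `𝒮(V)`: the set of `T ∈ (0,1)` with `S_V(T)` computable. -/
def setS (V : Computer) : Set ℝ := {T | T ∈ Set.Ioo 0 1 ∧ ComputableReal (Sfun V T)}

/-- `FP_w` (w.r.t. the optimal computer `U` fixing `H`): the set of `T ∈ (0,1)`
that are weakly Chaitin `T`-random and `T`-compressible. -/
def FPw (U : Computer) : Set ℝ :=
  {T | T ∈ Set.Ioo 0 1 ∧ WeaklyChaitinTRandom U T T ∧ TCompressible U T T}

/-- `FP` (w.r.t. the optimal computer `U` fixing `H`): the set of `T ∈ (0,1)`
that are Chaitin `T`-random and `T`-compressible. -/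
def FP (U : Computer) : Set ℝ :=
  {T | T ∈ Set.Ioo 0 1 ∧ ChaitinTRandom U T T ∧ TCompressible U T T}

/-- A computer is physically reasonable if its domain contains two strings of
different lengths. -/
def PhysicallyReasonable (C : Computer) : Prop :=
  ∃ p ∈ C.f.Dom, ∃ q ∈ C.f.Dom, p.length ≠ q.length

/-- A computable measure machine: `Z_C(1)` is a computable real. -/
def ComputableMeasureMachine (C : Computer) : Prop :=
  ComputableReal (Zfun C 1)

/-- `D` is the composition `C₀ ⊘ C₁ ⊘ ⋯ ⊘ C_{N-1}`: its domain consists of the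
concatenations `p₀p₁⋯p_{N-1}` with each `pᵢ ∈ Dom Cᵢ`, and on such a
concatenation it returns `C₀(p₀)`. -/
def IsComposition {N : ℕ} (C : Fin N → Computer) (hN : 0 < N) (D : Computer) : Prop :=
  (∀ l, l ∈ D.f.Dom ↔
      ∃ ps : Fin N → List Bool, (∀ i, ps i ∈ (C i).f.Dom) ∧ l = (List.ofFn ps).flatten) ∧
  (∀ ps : Fin N → List Bool, (∀ i, ps i ∈ (C i).f.Dom) →
      D.f ((List.ofFn ps).flatten) = (C ⟨0, hN⟩).f (ps ⟨0, hN⟩))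

/-- A sequence of computers is recursive if a single partial recursive function
uniformly computes all of them. -/
def RecursiveSeq (V : ℕ → Computer) : Prop :=
  ∃ F : ℕ × List Bool →. List Bool, Partrec F ∧ ∀ n p, (V n).f p = F (n, p)
attribute [fun_prop] Computable
namespace EPR
variable {α β γ σ : Type} [Primcodable α] [Primcodable β] [Primcodable γ] [Primcodable σ]

@[fun_prop] theorem c_id : Computable (fun x : α => x) := Computable.id
@[fun_prop] theorem c_const (c : β) : Computable (fun _ : α => c) := Computable.const c
@[fun_prop] theorem c_comp {f : β → σ} {g : α → β} (hf : Computable f) (hg : Computable g) :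
    Computable (fun x => f (g x)) := hf.comp hg
@[fun_prop] theorem c_pair {f : α → β} {g : α → γ} (hf : Computable f) (hg : Computable g) :
    Computable (fun x => (f x, g x)) := hf.pair hg
@[fun_prop] theorem c_fst {f : α → β × γ} (hf : Computable f) :
    Computable (fun x => (f x).1) := Computable.fst.comp hf
@[fun_prop] theorem c_snd {f : α → β × γ} (hf : Computable f) :
    Computable (fun x => (f x).2) := Computable.snd.comp hf
@[fun_prop] theorem c_add {f g : α → ℕ} (hf : Computable f) (hg : Computable g) :
    Computable (fun x => f x + g x) := (Primrec.nat_add.to_comp).comp hf hg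
@[fun_prop] theorem c_sub {f g : α → ℕ} (hf : Computable f) (hg : Computable g) :
    Computable (fun x => f x - g x) := (Primrec.nat_sub.to_comp).comp hf hg
@[fun_prop] theorem c_mul {f g : α → ℕ} (hf : Computable f) (hg : Computable g) :
    Computable (fun x => f x * g x) := (Primrec.nat_mul.to_comp).comp hf hg
@[fun_prop] theorem c_div {f g : α → ℕ} (hf : Computable f) (hg : Computable g) :
    Computable (fun x => f x / g x) := (Primrec.nat_div.to_comp).comp hf hg
@[fun_prop] theorem c_mod {f g : α → ℕ} (hf : Computable f) (hg : Computable g) :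
    Computable (fun x => f x % g x) := (Primrec.nat_mod.to_comp).comp hf hg
theorem primrec_pow : Primrec₂ (fun a b : ℕ => a ^ b) := Primrec₂.unpaired'.1 Nat.Primrec.pow
@[fun_prop] theorem c_pow {f g : α → ℕ} (hf : Computable f) (hg : Computable g) :
    Computable (fun x => f x ^ g x) := (primrec_pow.to_comp).comp hf hg
@[fun_prop] theorem c_npair {f g : α → ℕ} (hf : Computable f) (hg : Computable g) :
    Computable (fun x => Nat.pair (f x) (g x)) := (Primrec₂.natPair.to_comp).comp hf hg
@[fun_prop] theorem c_unpair {f : α → ℕ} (hf : Computable f) :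
    Computable (fun x => Nat.unpair (f x)) := Computable.unpair.comp hf
@[fun_prop] theorem c_succ {f : α → ℕ} (hf : Computable f) :
    Computable (fun x => Nat.succ (f x)) := Computable.succ.comp hf
@[fun_prop] theorem c_dle {f g : α → ℕ} (hf : Computable f) (hg : Computable g) :
    Computable (fun x => decide (f x ≤ g x)) := (Primrec.nat_le.decide.to_comp).comp hf hg
@[fun_prop] theorem c_dlt {f g : α → ℕ} (hf : Computable f) (hg : Computable g) :
    Computable (fun x => decide (f x < g x)) := (Primrec.nat_lt.decide.to_comp).comp hf hg
@[fun_prop] theorem c_deq [DecidableEq β] {f g : α → β} (hf : Computable f) (hg : Computable g) :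
    Computable (fun x => decide (f x = g x)) := (Primrec.eq.decide.to_comp).comp hf hg
@[fun_prop] theorem c_dand {p q : α → Prop} [DecidablePred p] [DecidablePred q]
    (hf : Computable (fun x => decide (p x))) (hg : Computable (fun x => decide (q x))) :
    Computable (fun x => decide (p x ∧ q x)) :=
  ((Primrec.and.to_comp).comp hf hg).of_eq (fun x => by simp)
@[fun_prop] theorem c_and {f g : α → Bool} (hf : Computable f) (hg : Computable g) :
    Computable (fun x => f x && g x) := (Primrec.and.to_comp).comp hf hg
@[fun_prop] theorem c_not {f : α → Bool} (hf : Computable f) :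
    Computable (fun x => !(f x)) := (Primrec.not.to_comp).comp hf
@[fun_prop] theorem c_ite {p : α → Prop} [DecidablePred p] {f g : α → β}
    (hp : Computable (fun x => decide (p x))) (hf : Computable f) (hg : Computable g) :
    Computable (fun x => if p x then f x else g x) :=
  (Computable.cond hp hf hg).of_eq (fun x => by by_cases h : p x <;> simp [h])
@[fun_prop] theorem c_some {f : α → β} (hf : Computable f) :
    Computable (fun x => some (f x)) := Computable.option_some.comp hf
@[fun_prop] theorem c_isSome {f : α → Option β} (hf : Computable f) :
    Computable (fun x => (f x).isSome) := Primrec.option_isSome.to_comp.comp hf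
@[fun_prop] theorem c_len {f : α → List β} (hf : Computable f) :
    Computable (fun x => (f x).length) := Computable.list_length.comp hf
@[fun_prop] theorem c_encode {f : α → β} (hf : Computable f) :
    Computable (fun x => Encodable.encode (f x)) := Computable.encode.comp hf

theorem c_natrec {f : α → ℕ} {g : α → σ} {h : α → ℕ → σ → σ} (hf : Computable f)
    (hg : Computable g) (hh : Computable (fun z : α × ℕ × σ => h z.1 z.2.1 z.2.2)) :
    Computable (fun a => Nat.rec (motive := fun _ => σ) (g a) (fun n s => h a n s) (f a)) :=
  Computable.nat_rec (h := fun a z => h a z.1 z.2) hf hg hh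

/-- total search -/
theorem c_search {R : α × ℕ → Bool} (hR : Computable R) (h : ∀ a, ∃ n, R (a, n) = true) :
    ∃ f : α → ℕ, Computable f ∧ ∀ a, R (a, f a) = true := by
  have hp : Partrec fun a => Nat.rfind (fun n => (Part.some (R (a, n)) : Part Bool)) :=
    Partrec.rfind (p := fun a n => Part.some (R (a, n))) hR.to₂.partrec₂
  have hd : ∀ a, (Nat.rfind (fun n => (Part.some (R (a, n)) : Part Bool))).Dom := by
    intro a
    obtain ⟨n, hn⟩ := h a
    obtain ⟨m, hm, _⟩ := Nat.rfind_min' (p := fun n => R (a, n)) (m := n) hn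
    exact (Part.dom_iff_mem.2 ⟨m, hm⟩)
  refine ⟨fun a => (Nat.rfind (fun n => (Part.some (R (a, n)) : Part Bool))).get (hd a),
    Partrec.of_eq_tot hp (fun a => Part.get_mem _), fun a => ?_⟩
  have := Nat.rfind_spec (Part.get_mem (hd a))
  exact (Part.mem_some_iff.1 this).symm

/-- partial search -/
theorem p_search {R : α × ℕ → Bool} (hR : Computable R) :
    ∃ f : α →. ℕ, Partrec f ∧ (∀ a n, n ∈ f a → R (a, n) = true) ∧
      (∀ a n, R (a, n) = true → ∃ m, m ∈ f a) := by
  have hp : Partrec fun a => Nat.rfind (fun n => (Part.some (R (a, n)) : Part Bool)) :=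
    Partrec.rfind (p := fun a n => Part.some (R (a, n))) hR.to₂.partrec₂
  refine ⟨_, hp, fun a n hn => ?_, fun a n hn => ?_⟩
  · have := Nat.rfind_spec hn
    exact (Part.mem_some_iff.1 this).symm
  · obtain ⟨m, hm, _⟩ := Nat.rfind_min' (p := fun n => R (a, n)) (m := n) hn
    exact ⟨m, hm⟩

/-- greatest witness below a bound -/
theorem c_findGreatest {p : α → ℕ → Prop} [∀ a n, Decidable (p a n)] {f : α → ℕ}
    (hf : Computable f) (hp : Computable (fun z : α × ℕ => decide (p z.1 z.2))) :
    Computable (fun a => Nat.findGreatest (p a) (f a)) := by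
  have : ∀ a n, Nat.findGreatest (p a) n =
      Nat.rec (motive := fun _ => ℕ) 0 (fun n s => if p a (n+1) then n+1 else s) n := by
    intro a n
    induction n with
    | zero => simp
    | succ n ih => rw [Nat.findGreatest_succ, ih]
  simp only [this]
  apply c_natrec hf (c_const 0)
  have h2 : Computable (fun z : α × ℕ × ℕ => decide (p z.1 (z.2.1+1))) :=
    hp.comp (g := fun z : α × ℕ × ℕ => (z.1, z.2.1+1)) (by fun_prop)
  exact c_ite h2 (by fun_prop) (by fun_prop)

end EPR

namespace EPR
open Encodable

theorem rat_enc_eq (q : ℚ) :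
    ∃ (s : Set ℕ) (_ : DecidablePred (· ∈ s)),
    s = Set.range (@encode ℚ Rat.instEncodable) ∧
    (@encode ℚ (Primcodable.toEncodable) q) =
      ((List.range (@encode ℚ Rat.instEncodable q)).countP (fun x => decide (x ∈ s))) := by
  refine ⟨_, decidableRangeEncode ℚ, rfl, rfl⟩

theorem rat_range_iff (x : ℕ) : x ∈ Set.range (@encode ℚ Rat.instEncodable) ↔
    0 < x.unpair.2 ∧ Nat.Coprime (x.unpair.1 / 2 + x.unpair.1 % 2) x.unpair.2 := by
  have key : ∀ z : ℤ, (encode z) / 2 + (encode z) % 2 = z.natAbs := by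
    intro z
    rcases z with n | n
    · change (2 * n) / 2 + (2*n) % 2 = n
      omega
    · change (2 * n + 1) / 2 + (2*n+1) % 2 = n + 1
      omega
  constructor
  · rintro ⟨q, rfl⟩
    have : @encode ℚ Rat.instEncodable q = Nat.pair (encode q.num) q.den := rfl
    rw [this, Nat.unpair_pair, key]
    exact ⟨q.den_pos, q.reduced⟩
  · rintro ⟨h1, h2⟩
    obtain ⟨z, hz⟩ : ∃ z : ℤ, encode z = x.unpair.1 := ⟨Denumerable.ofNat ℤ x.unpair.1, Denumerable.encode_ofNat _⟩
    rw [← hz, key] at h2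
    refine ⟨⟨z, x.unpair.2, h1.ne', h2⟩, ?_⟩
    have : @encode ℚ Rat.instEncodable ⟨z, x.unpair.2, h1.ne', h2⟩ = Nat.pair (encode z) x.unpair.2 := rfl
    rw [this, hz, Nat.pair_unpair]

@[fun_prop] theorem c_gcd {α : Type} [Primcodable α] {f g : α → ℕ} (hf : Computable f)
    (hg : Computable g) : Computable (fun x => Nat.gcd (f x) (g x)) := by
  have h : Computable (fun x : α => Nat.findGreatest
      (fun d => f x % d = 0 ∧ g x % d = 0) (f x + g x)) := by
    apply c_findGreatest
    · fun_prop
    · fun_prop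
  refine h.of_eq (fun x => ?_)
  rw [Nat.findGreatest_eq_iff]
  refine ⟨?_, ?_, ?_⟩
  · rcases Nat.eq_zero_or_pos (f x) with h | h
    · rw [h]; simp
    · exact (Nat.gcd_le_left _ h).trans (by omega)
  · intro _
    exact ⟨Nat.mod_eq_zero_of_dvd (Nat.gcd_dvd_left _ _), Nat.mod_eq_zero_of_dvd (Nat.gcd_dvd_right _ _)⟩
  · intro n hn hn2 ⟨h1, h2⟩
    have := Nat.dvd_gcd (Nat.dvd_of_mod_eq_zero h1) (Nat.dvd_of_mod_eq_zero h2)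
    rcases Nat.eq_zero_or_pos (Nat.gcd (f x) (g x)) with h0 | h0
    · rw [Nat.gcd_eq_zero_iff] at h0
      omega
    · exact absurd (Nat.le_of_dvd h0 this) (by omega)

def inS (x : ℕ) : Bool :=
  decide (0 < x.unpair.2 ∧ Nat.gcd (x.unpair.1 / 2 + x.unpair.1 % 2) x.unpair.2 = 1)

theorem c_inS : Computable inS := by unfold inS; fun_prop

def cntS (x : ℕ) : ℕ := Nat.rec (motive := fun _ => ℕ) 0 (fun n s => if inS n = true then s + 1 else s) x

theorem c_cntS : Computable cntS := by
  unfold cntS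
  apply c_natrec (f := fun x => x) (h := fun (_ : ℕ) n s => if inS n = true then s + 1 else s)
  · fun_prop
  · fun_prop
  · have := c_inS
    revert this
    generalize inS = p
    intro this
    exact c_ite (c_deq (by fun_prop) (by fun_prop)) (by fun_prop) (by fun_prop)

theorem cntS_eq (x : ℕ) : cntS x = (List.range x).countP inS := by
  induction x with
  | zero => rfl
  | succ n ih =>
    have : cntS (n+1) = if inS n = true then cntS n + 1 else cntS n := rfl
    rw [this, List.range_succ, List.countP_append, ih]
    by_cases h : inS n = true <;> simp [h]

theorem rat_enc (q : ℚ) : (@encode ℚ (Primcodable.toEncodable) q) =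
    cntS (Nat.pair (encode q.num) q.den) := by
  obtain ⟨s, hd, hs, h⟩ := rat_enc_eq q
  rw [h, cntS_eq]
  have e : @encode ℚ Rat.instEncodable q = Nat.pair (encode q.num) q.den := rfl
  rw [e]
  congr 1
  funext x
  unfold inS
  simp only [decide_eq_decide]
  rw [hs, rat_range_iff]

theorem cntS_mono {x y : ℕ} (h : x ≤ y) : cntS x ≤ cntS y := by
  induction y, h using Nat.le_induction with
  | base => rfl
  | succ n hn ih =>
    have : cntS (n+1) = if inS n = true then cntS n + 1 else cntS n := rfl
    rw [this]; split_ifs <;> omega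

theorem cntS_inj {x y : ℕ} (hx : inS x = true) (hy : inS y = true) (h : cntS x = cntS y) : x = y := by
  have aux : ∀ x y, inS x = true → x < y → cntS x < cntS y := by
    intro x y hx hxy
    have h1 : cntS (x+1) = if inS x = true then cntS x + 1 else cntS x := rfl
    have h2 := cntS_mono (show x + 1 ≤ y from hxy)
    rw [if_pos hx] at h1
    omega
  rcases lt_trichotomy x y with h1 | h1 | h1
  · have := aux _ _ hx h1; omega
  · exact h1
  · have := aux _ _ hy h1; omega

theorem c_rat : Computable (fun q : ℚ => Nat.pair (encode q.num) q.den) := by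
  have hin : ∀ q : ℚ, inS (Nat.pair (encode q.num) q.den) = true := by
    intro q
    have := (rat_range_iff (Nat.pair (encode q.num) q.den)).1 ⟨q, rfl⟩
    unfold inS
    exact decide_eq_true this
  have hR : Computable (fun z : ℚ × ℕ =>
      inS z.2 && decide (cntS z.2 = @encode ℚ (Primcodable.toEncodable) z.1)) := by
    refine c_and (c_inS.comp Computable.snd) (c_deq (c_cntS.comp Computable.snd) ?_)
    exact Computable.encode.comp Computable.fst
  obtain ⟨f, hf, hf2⟩ := c_search hR
    (fun q => ⟨Nat.pair (encode q.num) q.den, by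
      simp only [hin q, Bool.true_and]
      exact decide_eq_true (rat_enc q).symm⟩)
  refine hf.of_eq (fun q => ?_)
  have h := hf2 q
  rw [Bool.and_eq_true] at h
  exact cntS_inj h.1 (hin q) ((of_decide_eq_true h.2).trans (rat_enc q))

theorem c_ratnum : Computable (fun q : ℚ => q.num.toNat) := by
  have h := c_rat
  have h2 : Computable (fun x : ℕ => if (Nat.unpair x).1 % 2 = 0 then (Nat.unpair x).1 / 2 else 0) := by
    fun_prop
  refine (h2.comp h).of_eq (fun q => ?_)
  rw [Nat.unpair_pair]
  generalize q.num = z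
  rcases z with n | n
  · change (if (2 * n) % 2 = 0 then (2 * n) / 2 else 0) = n
    rw [if_pos (by omega)]; omega
  · change (if (2 * n + 1) % 2 = 0 then (2 * n + 1) / 2 else 0) = 0
    rw [if_neg (by omega)]

theorem c_ratden : Computable (fun q : ℚ => q.den) := by
  have h := c_rat
  have h2 : Computable (fun x : ℕ => (Nat.unpair x).2) := by
    fun_prop
  refine (h2.comp h).of_eq (fun q => ?_)
  rw [Nat.unpair_pair]

/-- a positive computable real has good lower and upper positive fractions -/
theorem comp_frac {T : ℝ} (h0 : 0 < T) (hT : ComputableReal T) :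
    ∃ a c b : ℕ → ℕ, Computable a ∧ Computable c ∧ Computable b ∧
      (∀ j, 0 < a j ∧ 0 < b j ∧ (a j : ℝ) / b j ≤ T ∧ T ≤ (c j : ℝ) / b j) ∧
      Filter.Tendsto (fun j => (a j : ℝ) / b j) Filter.atTop (nhds T) ∧
      Filter.Tendsto (fun j => (c j : ℝ) / b j) Filter.atTop (nhds T) := by
  obtain ⟨f, hf, hf2⟩ := hT
  obtain ⟨N, hN⟩ := exists_nat_gt (3 / T)
  have hNpos : 0 < N := by
    have : 0 < 3 / T := by positivity
    have : (0:ℝ) < N := this.trans hN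
    exact_mod_cast this
  have key : ∀ j : ℕ, 0 < (f (j+N)).num ∧ (1:ℝ)/(j+N) < f (j+N) := by
    intro j
    have h1 := hf2 (j+N) (by omega)
    have h2 : (3:ℝ) / T < (j + N : ℕ) := hN.trans_le (by push_cast; linarith [Nat.cast_nonneg (α := ℝ) j])
    have hp : (0:ℝ) < (j + N : ℕ) := by exact_mod_cast (by omega : 0 < j + N)
    have h3 : 3 / ((j + N : ℕ) : ℝ) < T := by
      rw [div_lt_iff₀ h0] at h2; rw [div_lt_iff₀ hp]; linarith
    have h4 : 3 / ((j + N : ℕ) : ℝ) = 3 * (1 / ((j + N : ℕ) : ℝ)) := by ring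
    have hq : 0 < 1 / ((j + N : ℕ) : ℝ) := by positivity
    rw [abs_lt] at h1
    have h5 : 1 / ((j + N : ℕ) : ℝ) < f (j+N) := by linarith
    refine ⟨?_, by push_cast at h5 ⊢; exact h5⟩
    rw [Rat.num_pos]
    have : (0:ℝ) < f (j+N) := hq.trans h5
    exact_mod_cast this
  have hn := c_ratnum
  have hd := c_ratden
  have hval : ∀ j, ((f (j+N)).num.toNat : ℝ) / (f (j+N)).den = f (j+N) := by
    intro j
    have h1 : (((f (j+N)).num.toNat : ℤ) : ℝ) = ((f (j+N)).num : ℝ) := by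
      rw [Int.toNat_of_nonneg (key j).1.le]
    rw [Int.cast_natCast] at h1
    rw [h1]
    exact (Rat.cast_def _).symm
  have hlo : ∀ j, (((f (j+N)).num.toNat * (j+N) - (f (j+N)).den : ℕ) : ℝ) / (((f (j+N)).den * (j+N) : ℕ) : ℝ) = f (j+N) - 1 / ((j:ℝ)+N) ∧ (f (j+N)).den < (f (j+N)).num.toNat * (j+N) := by
    intro j
    have hp : (0:ℝ) < (j:ℝ) + N := by exact_mod_cast (by omega : 0 < j + N)
    have hdp : (0:ℝ) < (f (j+N)).den := by exact_mod_cast (f (j+N)).den_pos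
    have h1 : (f (j+N)).den < (f (j+N)).num.toNat * (j+N) := by
      have := (key j).2
      rw [← hval j, div_lt_div_iff₀ hp hdp, one_mul] at this
      exact_mod_cast this
    refine ⟨?_, h1⟩
    rw [Nat.cast_sub h1.le, ← hval j]
    push_cast
    field_simp
  have hhi : ∀ j, (((f (j+N)).num.toNat * (j+N) + (f (j+N)).den : ℕ) : ℝ) / (((f (j+N)).den * (j+N) : ℕ) : ℝ) = f (j+N) + 1 / ((j:ℝ)+N) := by
    intro j
    have hp : (0:ℝ) < (j:ℝ) + N := by exact_mod_cast (by omega : 0 < j + N)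
    have hdp : (0:ℝ) < (f (j+N)).den := by exact_mod_cast (f (j+N)).den_pos
    rw [← hval j]
    push_cast
    field_simp
  have hinv : Filter.Tendsto (fun j : ℕ => 1 / ((j:ℝ) + N)) Filter.atTop (nhds 0) := by
    have := (Filter.tendsto_add_atTop_iff_nat N).2 (tendsto_one_div_atTop_nhds_zero_nat (𝕜 := ℝ))
    simpa using this
  have hlim : Filter.Tendsto (fun j : ℕ => ((f (j+N) : ℚ) : ℝ)) Filter.atTop (nhds T) := by
    rw [tendsto_iff_dist_tendsto_zero]
    refine squeeze_zero (fun _ => dist_nonneg) (fun j => ?_) hinv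
    have := (hf2 (j+N) (by omega)).le
    rw [dist_comm, Real.dist_eq]
    push_cast at this
    exact this
  refine ⟨fun j => (f (j+N)).num.toNat * (j+N) - (f (j+N)).den,
    fun j => (f (j+N)).num.toNat * (j+N) + (f (j+N)).den,
    fun j => (f (j+N)).den * (j+N), ?_, ?_, ?_, ?_, ?_, ?_⟩
  · have h1 : Computable fun j => (f (j+N)).num.toNat := hn.comp (hf.comp (by fun_prop))
    have h2 : Computable fun j => (f (j+N)).den := hd.comp (hf.comp (by fun_prop))
    fun_prop
  · have h1 : Computable fun j => (f (j+N)).num.toNat := hn.comp (hf.comp (by fun_prop))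
    have h2 : Computable fun j => (f (j+N)).den := hd.comp (hf.comp (by fun_prop))
    fun_prop
  · have h2 : Computable fun j => (f (j+N)).den := hd.comp (hf.comp (by fun_prop))
    fun_prop
  · intro j
    have h1 := hf2 (j+N) (by omega)
    rw [abs_lt] at h1
    push_cast at h1
    refine ⟨Nat.sub_pos_of_lt (hlo j).2, Nat.mul_pos (f (j+N)).den_pos (by omega), ?_, ?_⟩
    · rw [(hlo j).1]; linarith
    · rw [hhi j]; linarith
  · simp only [fun j => (hlo j).1]
    simpa using hlim.sub hinv
  · simp only [hhi]
    simpa using hlim.add hinv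
end EPR

namespace EPR
variable {α : Type} [Primcodable α]

/-- `F` is uniformly approximable from below by fractions. -/
def Low (F : α → ℝ) : Prop := ∃ a b : α × ℕ → ℕ, Computable a ∧ Computable b ∧ (∀ z, 0 < b z) ∧
  (∀ z, (a z : ℝ) / b z ≤ F z.1) ∧ ∀ x, Tendsto (fun j => (a (x, j) : ℝ) / b (x, j)) atTop (𝓝 (F x))

/-- `F` is uniformly approximable from above by fractions. -/
def Upp (F : α → ℝ) : Prop := ∃ a b : α × ℕ → ℕ, Computable a ∧ Computable b ∧ (∀ z, 0 < b z) ∧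
  (∀ z, F z.1 ≤ (a z : ℝ) / b z) ∧ ∀ x, Tendsto (fun j => (a (x, j) : ℝ) / b (x, j)) atTop (𝓝 (F x))

def CR (F : α → ℝ) : Prop := Low F ∧ Upp F

theorem CR.nat {f : α → ℕ} (hf : Computable f) : CR (fun x => (f x : ℝ)) := by
  refine ⟨⟨fun z => f z.1, fun _ => 1, by fun_prop, by fun_prop, ?_, ?_, ?_⟩,
    ⟨fun z => f z.1, fun _ => 1, by fun_prop, by fun_prop, ?_, ?_, ?_⟩⟩ <;> simp

theorem CR.comp {β : Type} [Primcodable β] {F : α → ℝ} (h : CR F) {g : β → α} (hg : Computable g) :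
    CR (fun x => F (g x)) := by
  obtain ⟨⟨a, b, ha, hb, h1, h2, h3⟩, ⟨a', b', ha', hb', h1', h2', h3'⟩⟩ := h
  exact ⟨⟨fun z => a (g z.1, z.2), fun z => b (g z.1, z.2), by fun_prop, by fun_prop,
    fun z => h1 _, fun z => h2 _, fun x => h3 _⟩,
    ⟨fun z => a' (g z.1, z.2), fun z => b' (g z.1, z.2), by fun_prop, by fun_prop,
    fun z => h1' _, fun z => h2' (g z.1, z.2), fun x => h3' _⟩⟩

theorem frac_add (a b c d : ℕ) (hb : 0 < b) (hd : 0 < d) :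
    ((a * d + c * b : ℕ) : ℝ) / ((b * d : ℕ) : ℝ) = (a : ℝ) / b + (c : ℝ) / d := by
  have : (0:ℝ) < b := by exact_mod_cast hb
  have : (0:ℝ) < d := by exact_mod_cast hd
  push_cast; field_simp

theorem frac_mul (a b c d : ℕ) :
    ((a * c : ℕ) : ℝ) / ((b * d : ℕ) : ℝ) = (a : ℝ) / b * ((c : ℝ) / d) := by
  push_cast; rw [div_mul_div_comm]

theorem CR.add {F G : α → ℝ} (hF : CR F) (hG : CR G) : CR (fun x => F x + G x) := by
  obtain ⟨⟨a, b, ha, hb, h1, h2, h3⟩, ⟨a', b', ha', hb', h1', h2', h3'⟩⟩ := hF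
  obtain ⟨⟨c, d, hc, hd, g1, g2, g3⟩, ⟨c', d', hc', hd', g1', g2', g3'⟩⟩ := hG
  refine ⟨⟨fun z => a z * d z + c z * b z, fun z => b z * d z, by fun_prop, by fun_prop,
    fun z => Nat.mul_pos (h1 z) (g1 z), fun z => ?_, fun x => ?_⟩,
    ⟨fun z => a' z * d' z + c' z * b' z, fun z => b' z * d' z, by fun_prop, by fun_prop,
    fun z => Nat.mul_pos (h1' z) (g1' z), fun z => ?_, fun x => ?_⟩⟩
  · rw [frac_add _ _ _ _ (h1 z) (g1 z)]; exact add_le_add (h2 z) (g2 z)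
  · simp only [frac_add _ _ _ _ (h1 _) (g1 _)]; exact (h3 x).add (g3 x)
  · rw [frac_add _ _ _ _ (h1' z) (g1' z)]; exact add_le_add (h2' z) (g2' z)
  · simp only [frac_add _ _ _ _ (h1' _) (g1' _)]; exact (h3' x).add (g3' x)

theorem frac_nonneg (a b : ℕ) : (0:ℝ) ≤ (a:ℝ) / b := by positivity

theorem CR.mul {F G : α → ℝ} (hF : CR F) (hG : CR G) (pF : ∀ x, 0 ≤ F x) (pG : ∀ x, 0 ≤ G x) :
    CR (fun x => F x * G x) := by
  obtain ⟨⟨a, b, ha, hb, h1, h2, h3⟩, ⟨a', b', ha', hb', h1', h2', h3'⟩⟩ := hF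
  obtain ⟨⟨c, d, hc, hd, g1, g2, g3⟩, ⟨c', d', hc', hd', g1', g2', g3'⟩⟩ := hG
  refine ⟨⟨fun z => a z * c z, fun z => b z * d z, by fun_prop, by fun_prop,
    fun z => Nat.mul_pos (h1 z) (g1 z), fun z => ?_, fun x => ?_⟩,
    ⟨fun z => a' z * c' z, fun z => b' z * d' z, by fun_prop, by fun_prop,
    fun z => Nat.mul_pos (h1' z) (g1' z), fun z => ?_, fun x => ?_⟩⟩
  · rw [frac_mul]; exact mul_le_mul (h2 z) (g2 z) (frac_nonneg _ _) (pF _)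
  · simp only [frac_mul]; exact (h3 x).mul (g3 x)
  · rw [frac_mul]; exact mul_le_mul (h2' z) (g2' z) (pG _) (frac_nonneg _ _)
  · simp only [frac_mul]; exact (h3' x).mul (g3' x)

theorem frac_pow (a b l : ℕ) :
    ((a ^ l : ℕ) : ℝ) / ((b ^ l : ℕ) : ℝ) = ((a : ℝ) / b) ^ l := by
  push_cast; rw [div_pow]

theorem CR.pow {F : α → ℝ} (hF : CR F) {l : α → ℕ} (hl : Computable l) (pF : ∀ x, 0 ≤ F x) :
    CR (fun x => F x ^ l x) := by
  obtain ⟨⟨a, b, ha, hb, h1, h2, h3⟩, ⟨a', b', ha', hb', h1', h2', h3'⟩⟩ := hF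
  refine ⟨⟨fun z => a z ^ l z.1, fun z => b z ^ l z.1, by fun_prop, by fun_prop,
    fun z => Nat.pow_pos (h1 z), fun z => ?_, fun x => ?_⟩,
    ⟨fun z => a' z ^ l z.1, fun z => b' z ^ l z.1, by fun_prop, by fun_prop,
    fun z => Nat.pow_pos (h1' z), fun z => ?_, fun x => ?_⟩⟩
  · rw [frac_pow]; exact pow_le_pow_left₀ (frac_nonneg _ _) (h2 z) _
  · simp only [frac_pow]; exact (h3 x).pow _
  · rw [frac_pow]; exact pow_le_pow_left₀ (pF _) (h2' z) _
  · simp only [frac_pow]; exact (h3' x).pow _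

/-- partial sums of fractions -/
def fsum (a b : ℕ × ℕ → ℕ) (k j : ℕ) : ℕ × ℕ :=
  Nat.rec (motive := fun _ => ℕ × ℕ) (0, 1)
    (fun i s => (s.1 * b (i, j) + a (i, j) * s.2, s.2 * b (i, j))) k

theorem c_fsum {a b : ℕ × ℕ → ℕ} (ha : Computable a) (hb : Computable b) :
    Computable (fun z : ℕ × ℕ => fsum a b z.1 z.2) := by
  unfold fsum
  exact c_natrec (f := fun z : ℕ × ℕ => z.1) (g := fun _ => ((0, 1) : ℕ × ℕ))
    (h := fun z i s => (s.1 * b (i, z.2) + a (i, z.2) * s.2, s.2 * b (i, z.2)))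
    (by fun_prop) (by fun_prop) (by fun_prop)

theorem fsum_spec {a b : ℕ × ℕ → ℕ} (hb : ∀ z, 0 < b z) (k j : ℕ) :
    0 < (fsum a b k j).2 ∧ ((fsum a b k j).1 : ℝ) / ((fsum a b k j).2 : ℝ) =
      ∑ i ∈ Finset.range k, (a (i, j) : ℝ) / b (i, j) := by
  induction k with
  | zero => simp [fsum]
  | succ k ih =>
    have : fsum a b (k+1) j = ((fsum a b k j).1 * b (k, j) + a (k, j) * (fsum a b k j).2,
      (fsum a b k j).2 * b (k, j)) := rfl
    rw [this, Finset.sum_range_succ, ← ih.2]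
    exact ⟨Nat.mul_pos ih.1 (hb _), frac_add _ _ _ _ ih.1 (hb _)⟩

theorem CR.sum {F : ℕ → ℝ} (hF : CR F) : CR (fun k => ∑ i ∈ Finset.range k, F i) := by
  obtain ⟨⟨a, b, ha, hb, h1, h2, h3⟩, ⟨a', b', ha', hb', h1', h2', h3'⟩⟩ := hF
  have hc := c_fsum ha hb
  have hc' := c_fsum ha' hb'
  refine ⟨⟨fun z => (fsum a b z.1 z.2).1, fun z => (fsum a b z.1 z.2).2, c_fst hc, c_snd hc,
    fun z => (fsum_spec h1 _ _).1, fun z => ?_, fun x => ?_⟩,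
    ⟨fun z => (fsum a' b' z.1 z.2).1, fun z => (fsum a' b' z.1 z.2).2, c_fst hc', c_snd hc',
    fun z => (fsum_spec h1' _ _).1, fun z => ?_, fun x => ?_⟩⟩
  · rw [(fsum_spec h1 _ _).2]; exact Finset.sum_le_sum (fun i _ => h2 (i, z.2))
  · simp only [(fsum_spec h1 _ _).2]; exact tendsto_finsetSum _ (fun i _ => h3 i)
  · rw [(fsum_spec h1' _ _).2]; exact Finset.sum_le_sum (fun i _ => h2' (i, z.2))
  · simp only [(fsum_spec h1' _ _).2]; exact tendsto_finsetSum _ (fun i _ => h3' i)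

theorem CR.inv {F : α → ℝ} (hF : CR F) (c : ℕ) (hc : 0 < c) (pF : ∀ x, 1 / (c:ℝ) ≤ F x) :
    CR (fun x => (F x)⁻¹) := by
  have hc' : (0:ℝ) < c := by exact_mod_cast hc
  have pos : ∀ x, 0 < F x := fun x => lt_of_lt_of_le (by positivity) (pF x)
  obtain ⟨⟨a, b, ha, hb, h1, h2, h3⟩, ⟨a', b', ha', hb', h1', h2', h3'⟩⟩ := hF
  have hap : ∀ z, 0 < a' z := by
    intro z
    rcases Nat.eq_zero_or_pos (a' z) with h | h
    · have := h2' z; rw [h] at this; simp at this; exact absurd (pos z.1) (by linarith)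
    · exact h
  refine ⟨⟨b', a', hb', ha', hap, fun z => ?_, fun x => ?_⟩, ?_⟩
  · rw [← inv_div]; exact inv_anti₀ (pos _) (h2' z)
  · have := (h3' x).inv₀ (pos x).ne'
    simpa only [inv_div] using this
  · refine ⟨fun z => if b z ≤ a z * c then b z else c, fun z => if b z ≤ a z * c then a z else 1,
      by fun_prop, by fun_prop, fun z => ?_, fun z => ?_, fun x => ?_⟩
    · beta_reduce; split_ifs with h
      · have := h1 z
        rcases Nat.eq_zero_or_pos (a z) with h0 | h0
        · rw [h0] at h; omega
        · exact h0
      · exact one_pos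
    · beta_reduce; split_ifs with h
      · have hb0 := h1 z
        have ha0 : 0 < a z := by
          rcases Nat.eq_zero_or_pos (a z) with h0 | h0
          · rw [h0] at h; omega
          · exact h0
        have : (0:ℝ) < (a z : ℝ) / b z := by positivity
        rw [← inv_div]; exact inv_anti₀ this (h2 z)
      · have := inv_anti₀ (by positivity) (pF z.1)
        simpa using this
    · have h4 : Tendsto (fun j => (max ((a (x, j) : ℝ) / b (x, j)) (1 / (c:ℝ)))⁻¹) atTop (𝓝 ((F x)⁻¹)) := by
        have := (h3 x).max (tendsto_const_nhds (x := 1 / (c:ℝ)))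
        rw [max_eq_left (pF x)] at this
        exact this.inv₀ (pos x).ne'
      refine h4.congr (fun j => ?_)
      have hb0 : (0:ℝ) < b (x, j) := by exact_mod_cast h1 (x, j)
      have e : b (x, j) ≤ a (x, j) * c ↔ 1 / (c:ℝ) ≤ (a (x, j) : ℝ) / b (x, j) := by
        rw [div_le_div_iff₀ hc' hb0, one_mul]; norm_cast
      by_cases h : b (x, j) ≤ a (x, j) * c
      · beta_reduce; rw [if_pos h, if_pos h, max_eq_left (e.1 h), inv_div]
      · beta_reduce; rw [if_neg h, if_neg h, max_eq_right (le_of_not_ge (fun h' => h (e.2 h')))]; simp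

/-- From a computable real function extract integer approximations. -/
theorem CR.approx {F : α → ℝ} (hF : CR F) (pF : ∀ x, 0 ≤ F x) :
    ∃ m : α × ℕ → ℕ, Computable m ∧ ∀ x n, |(m (x, n) : ℝ) - 2 ^ n * F x| ≤ 1 := by
  obtain ⟨⟨a, b, ha, hb, h1, h2, h3⟩, ⟨a', b', ha', hb', h1', h2', h3'⟩⟩ := hF
  obtain ⟨f, hf, hf2⟩ := c_search (α := α × ℕ)
    (R := fun z => decide (2 ^ z.1.2 * a' (z.1.1, z.2.unpair.2) ≤ (z.2.unpair.1 + 1) * b' (z.1.1, z.2.unpair.2) ∧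
      z.2.unpair.1 * b (z.1.1, z.2.unpair.2) ≤ 2 ^ z.1.2 * a (z.1.1, z.2.unpair.2) + b (z.1.1, z.2.unpair.2)))
    (by fun_prop) (by
      rintro ⟨x, n⟩
      have p2 : (0:ℝ) < 2 ^ n := by positivity
      set m := ⌊2 ^ n * F x + 1/2⌋₊ with hm
      have m1 : (m:ℝ) ≤ 2 ^ n * F x + 1/2 := Nat.floor_le (by have := pF x; positivity)
      have m2 : 2 ^ n * F x + 1/2 < m + 1 := Nat.lt_floor_add_one _
      have e1 : ∀ᶠ j in atTop, 2 ^ n * ((a' (x, j) : ℝ) / b' (x, j)) < m + 1 :=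
        ((h3' x).const_mul (2^n)).eventually_lt_const (by linarith)
      have e2 : ∀ᶠ j in atTop, (m:ℝ) - 1 < 2 ^ n * ((a (x, j) : ℝ) / b (x, j)) :=
        ((h3 x).const_mul (2^n)).eventually_const_lt (by linarith)
      obtain ⟨j, hj1, hj2⟩ := (e1.and e2).exists
      refine ⟨Nat.pair m j, decide_eq_true ?_⟩
      simp only [Nat.unpair_pair]
      have hb0 : (0:ℝ) < b (x, j) := by exact_mod_cast h1 (x, j)
      have hb0' : (0:ℝ) < b' (x, j) := by exact_mod_cast h1' (x, j)
      constructor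
      · rw [← mul_div_assoc, div_lt_iff₀ hb0'] at hj1
        exact_mod_cast hj1.le
      · rw [← mul_div_assoc, lt_div_iff₀ hb0] at hj2
        have : (m:ℝ) * b (x, j) ≤ 2 ^ n * a (x, j) + b (x, j) := by linarith
        exact_mod_cast this)
  refine ⟨fun z => (f z).unpair.1, by fun_prop, fun x n => ?_⟩
  have := of_decide_eq_true (hf2 (x, n))
  simp only at this
  set j := (f (x, n)).unpair.2
  set m := (f (x, n)).unpair.1
  obtain ⟨t1, t2⟩ := this
  have p2 : (0:ℝ) < 2 ^ n := by positivity
  have hb0 : (0:ℝ) < b (x, j) := by exact_mod_cast h1 (x, j)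
  have hb0' : (0:ℝ) < b' (x, j) := by exact_mod_cast h1' (x, j)
  have t1' : (2:ℝ) ^ n * a' (x, j) ≤ (m + 1) * b' (x, j) := by exact_mod_cast t1
  have t2' : (m:ℝ) * b (x, j) ≤ 2 ^ n * a (x, j) + b (x, j) := by exact_mod_cast t2
  have u1 := h2 (x, j)
  have u2 := h2' (x, j)
  simp only at u1 u2
  have v1 : 2 ^ n * F x ≤ m + 1 := by
    calc 2 ^ n * F x ≤ 2 ^ n * ((a' (x, j) : ℝ) / b' (x, j)) := by gcongr
      _ = 2 ^ n * (a' (x, j) : ℝ) / b' (x, j) := by rw [mul_div_assoc]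
      _ ≤ m + 1 := by rw [div_le_iff₀ hb0']; exact t1'
  have v2 : (m:ℝ) - 1 ≤ 2 ^ n * F x := by
    calc (m:ℝ) - 1 ≤ 2 ^ n * (a (x, j) : ℝ) / b (x, j) := by rw [le_div_iff₀ hb0]; linarith
      _ = 2 ^ n * ((a (x, j) : ℝ) / b (x, j)) := by rw [mul_div_assoc]
      _ ≤ _ := by gcongr
  rw [abs_le]; constructor <;> linarith

end EPR

namespace EPR
variable {α : Type} [Primcodable α]

def ylog (a b N : ℕ) : ℕ := Nat.findGreatest (fun y => 2 ^ y * b ^ N ≤ a ^ N) (a * N)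

theorem c_ylog {a b N : α → ℕ} (ha : Computable a) (hb : Computable b) (hN : Computable N) :
    Computable (fun x => ylog (a x) (b x) (N x)) := by
  unfold ylog
  exact c_findGreatest (p := fun x y => 2 ^ y * b x ^ N x ≤ a x ^ N x) (f := fun x => a x * N x)
    (by fun_prop) (by fun_prop)

theorem ylog_spec (a b N : ℕ) (hb : 0 < b) (hN : 0 < N) :
    (ylog a b N : ℝ) / N ≤ Real.logb 2 (max 1 ((a:ℝ) / b)) ∧
    Real.logb 2 (max 1 ((a:ℝ) / b)) ≤ ((ylog a b N : ℝ) + 1) / N := by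
  have hN' : (0:ℝ) < N := by exact_mod_cast hN
  have hb' : (0:ℝ) < b := by exact_mod_cast hb
  have key : ∀ y : ℕ, 2 ^ y * b ^ N ≤ a ^ N ↔ (2:ℝ) ^ y ≤ ((a:ℝ)/b) ^ N := by
    intro y
    rw [div_pow, le_div_iff₀ (by positivity)]; norm_cast
  have hm : (1:ℝ) ≤ max 1 ((a:ℝ) / b) := le_max_left _ _
  have lg : ∀ y : ℕ, (y:ℝ) / N ≤ Real.logb 2 (max 1 ((a:ℝ) / b)) ↔ (2:ℝ) ^ y ≤ (max 1 ((a:ℝ)/b)) ^ N := by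
    intro y
    rw [div_le_iff₀ hN', mul_comm, ← Real.logb_pow, Real.le_logb_iff_rpow_le (by norm_num) (by positivity),
      Real.rpow_natCast]
  constructor
  · rw [lg]
    rcases Nat.eq_zero_or_pos (ylog a b N) with h | h
    · rw [h, pow_zero]; exact one_le_pow₀ hm
    · have := Nat.findGreatest_of_ne_zero (P := fun y => 2 ^ y * b ^ N ≤ a ^ N) (n := a * N) (m := ylog a b N) rfl h.ne'
      refine ((key _).1 this).trans ?_
      exact pow_le_pow_left₀ (by positivity) (le_max_right _ _) _
  · by_contra hc
    push Not at hc
    have h1 : (2:ℝ) ^ (ylog a b N + 1) ≤ (max 1 ((a:ℝ)/b)) ^ N := by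
      rw [← lg]; push_cast; exact hc.le
    have h2 : (1:ℝ) < (a:ℝ)/b := by
      by_contra h
      rw [max_eq_left (not_lt.1 h), one_pow] at h1
      have : (2:ℝ) ^ 1 ≤ 2 ^ (ylog a b N + 1) := pow_le_pow_right₀ (by norm_num) (by omega)
      linarith
    rw [max_eq_right h2.le] at h1
    have h3 := (key _).2 h1
    have h4 : ylog a b N + 1 ≤ a * N := by
      have : 2 ^ (ylog a b N + 1) ≤ 2 ^ (a * N) := by
        calc 2 ^ (ylog a b N + 1) ≤ 2 ^ (ylog a b N + 1) * b ^ N := Nat.le_mul_of_pos_right _ (by positivity)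
          _ ≤ a ^ N := h3
          _ ≤ (2 ^ a) ^ N := Nat.pow_le_pow_left (Nat.lt_two_pow_self).le _
          _ = 2 ^ (a * N) := by rw [← pow_mul]
      exact (Nat.pow_le_pow_iff_right (by norm_num)).1 this
    have := Nat.le_findGreatest (P := fun y => 2 ^ y * b ^ N ≤ a ^ N) h4 h3
    change _ ≤ ylog a b N at this
    omega

theorem t_one : Tendsto (fun j : ℕ => 1 / ((j + 1 : ℕ):ℝ)) atTop (𝓝 0) := by
  simpa using tendsto_one_div_add_atTop_nhds_zero_nat (𝕜 := ℝ)

theorem sq1 {u v : ℕ → ℝ} {c : ℝ} (h1 : ∀ j, u j ≤ v j) (h2 : ∀ j, v j ≤ u j + 1 / ((j + 1 : ℕ):ℝ))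
    (hv : Tendsto v atTop (𝓝 c)) : Tendsto u atTop (𝓝 c) := by
  refine tendsto_of_tendsto_of_tendsto_of_le_of_le (g := fun j => v j - 1 / ((j + 1 : ℕ):ℝ)) (h := v) ?_ hv
    (fun j => by have := h2 j; dsimp only; linarith) h1
  simpa using hv.sub t_one

theorem sq2 {u v : ℕ → ℝ} {c : ℝ} (h1 : ∀ j, v j ≤ u j) (h2 : ∀ j, u j ≤ v j + 1 / ((j + 1 : ℕ):ℝ))
    (hv : Tendsto v atTop (𝓝 c)) : Tendsto u atTop (𝓝 c) := by
  refine tendsto_of_tendsto_of_tendsto_of_le_of_le (g := v) (h := fun j => v j + 1 / ((j + 1 : ℕ):ℝ)) hv ?_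
    h1 h2
  simpa using hv.add t_one

theorem CR.log {F : α → ℝ} (hF : CR F) (pF : ∀ x, 1 ≤ F x) : CR (fun x => Real.logb 2 (F x)) := by
  obtain ⟨⟨a, b, ha, hb, h1, h2, h3⟩, ⟨a', b', ha', hb', h1', h2', h3'⟩⟩ := hF
  have pos : ∀ x, 0 < F x := fun x => lt_of_lt_of_le one_pos (pF x)
  have tl : ∀ x (u : ℕ → ℝ), Tendsto u atTop (𝓝 (F x)) →
      Tendsto (fun j => Real.logb 2 (max 1 (u j))) atTop (𝓝 (Real.logb 2 (F x))) := by
    intro x u hu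
    have h4 := (tendsto_const_nhds (x := (1:ℝ))).max hu
    rw [max_eq_right (pF x)] at h4
    exact (Real.continuousAt_logb (pos x).ne').tendsto.comp h4
  have mono : ∀ u v : ℝ, 1 ≤ u → u ≤ v → Real.logb 2 u ≤ Real.logb 2 v := fun u v hu huv =>
    Real.logb_le_logb_of_le (by norm_num) (by linarith) huv
  refine ⟨⟨fun z => ylog (a z) (b z) (z.2 + 1), fun z => z.2 + 1,
    c_ylog ha hb (by fun_prop), by fun_prop, fun z => Nat.succ_pos _, fun z => ?_, fun x => ?_⟩,
    ⟨fun z => ylog (a' z) (b' z) (z.2 + 1) + 1, fun z => z.2 + 1,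
    c_succ (c_ylog ha' hb' (by fun_prop)), by fun_prop, fun z => Nat.succ_pos _, fun z => ?_, fun x => ?_⟩⟩
  · refine (ylog_spec (a z) (b z) (z.2 + 1) (h1 z) (Nat.succ_pos _)).1.trans ?_
    exact mono _ _ (le_max_left _ _) (max_le (pF _) (h2 z))
  · refine sq1 (fun j => (ylog_spec _ _ _ (h1 (x, j)) (Nat.succ_pos _)).1) (fun j => ?_) (tl x _ (h3 x))
    have := (ylog_spec (a (x, j)) _ (j+1) (h1 (x, j)) (Nat.succ_pos _)).2
    rwa [add_div] at this
  · have := (ylog_spec (a' z) (b' z) (z.2 + 1) (h1' z) (Nat.succ_pos _)).2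
    push_cast at this ⊢
    refine le_trans ?_ this
    exact mono _ _ (pF _) ((h2' z).trans (le_max_right _ _))
  · refine sq2 (fun j => ?_) (fun j => ?_) (tl x _ (h3' x))
    · have := (ylog_spec (a' (x, j)) (b' (x, j)) (j + 1) (h1' (x, j)) (Nat.succ_pos _)).2
      push_cast at this ⊢; exact this
    · have := (ylog_spec (a' (x, j)) (b' (x, j)) (j + 1) (h1' (x, j)) (Nat.succ_pos _)).1
      push_cast at this ⊢; rw [add_div]; linarith

def xb (a b N : ℕ) : ℕ := Nat.findGreatest (fun x => x ^ a * 2 ^ b ≤ N ^ a) N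

theorem c_xb {a b N : α → ℕ} (ha : Computable a) (hb : Computable b) (hN : Computable N) :
    Computable (fun x => xb (a x) (b x) (N x)) := by
  unfold xb
  exact c_findGreatest (p := fun x y => y ^ a x * 2 ^ b x ≤ N x ^ a x) (f := fun x => N x)
    (by fun_prop) (by fun_prop)

theorem xb_spec (a b N : ℕ) (ha : 0 < a) (hb : 0 < b) (hN : 0 < N) :
    (xb a b N : ℝ) / N ≤ (2:ℝ) ^ (-((a:ℝ)/b)⁻¹) ∧ (2:ℝ) ^ (-((a:ℝ)/b)⁻¹) ≤ ((xb a b N : ℝ) + 1) / N := by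
  have hN' : (0:ℝ) < N := by exact_mod_cast hN
  have ha' : (0:ℝ) < a := by exact_mod_cast ha
  have hb' : (0:ℝ) < b := by exact_mod_cast hb
  have key : ∀ x : ℕ, x ^ a * 2 ^ b ≤ N ^ a ↔ (x:ℝ) / N ≤ (2:ℝ) ^ (-((a:ℝ)/b)⁻¹) := by
    intro x
    have e : ((2:ℝ) ^ (-((a:ℝ)/b)⁻¹)) ^ a = (2 ^ b)⁻¹ := by
      rw [← Real.rpow_natCast, ← Real.rpow_mul (by norm_num), ← Real.rpow_natCast 2 b, ← Real.rpow_neg (by norm_num)]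
      congr 1; field_simp
    rw [← pow_le_pow_iff_left₀ (a := (x:ℝ)/N) (by positivity) (by positivity) ha.ne', e, div_pow, div_le_iff₀ (by positivity),
      inv_mul_eq_div, le_div_iff₀ (by positivity)]
    norm_cast
  have le1 : (2:ℝ) ^ (-((a:ℝ)/b)⁻¹) < 1 := Real.rpow_lt_one_of_one_lt_of_neg (by norm_num) (by
    have : (0:ℝ) < ((a:ℝ)/b)⁻¹ := by positivity
    linarith)
  constructor
  · rw [← key]
    rcases Nat.eq_zero_or_pos (xb a b N) with h | h
    · rw [h, zero_pow ha.ne']; simp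
    · exact Nat.findGreatest_of_ne_zero (P := fun x => x ^ a * 2 ^ b ≤ N ^ a) (n := N) (m := xb a b N) rfl h.ne'
  · by_contra hc
    push Not at hc
    have h0 : ((xb a b N + 1 : ℕ) : ℝ) / N ≤ (2:ℝ) ^ (-((a:ℝ)/b)⁻¹) := by push_cast; exact hc.le
    have h3 := (key _).2 h0
    have h4 : xb a b N + 1 ≤ N := by
      have : ((xb a b N + 1 : ℕ) : ℝ) / N < 1 := lt_of_le_of_lt h0 le1
      rw [div_lt_one hN'] at this
      exact_mod_cast this.le
    have := Nat.le_findGreatest (P := fun x => x ^ a * 2 ^ b ≤ N ^ a) h4 h3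
    change _ ≤ xb a b N at this
    omega

theorem CR.temp {T : ℝ} (h0 : 0 < T) (hT : ComputableReal T) :
    CR (fun _ : α => T) ∧ CR (fun _ : α => (2:ℝ) ^ (-T⁻¹)) := by
  obtain ⟨a, c, b, ha, hc, hb, h, ta, tc⟩ := comp_frac h0 hT
  have hapos : ∀ j, (0:ℝ) < (a j : ℝ) / b j := fun j => by
    have h1 : (0:ℝ) < a j := by exact_mod_cast (h j).1
    have h2 : (0:ℝ) < b j := by exact_mod_cast (h j).2.1
    positivity
  have hcp : ∀ j, 0 < c j := fun j => by
    rcases Nat.eq_zero_or_pos (c j) with hh | hh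
    · have := (h j).2.2.2; rw [hh] at this; simp at this; linarith
    · exact hh
  have mono : ∀ u v : ℝ, 0 < u → u ≤ v → (2:ℝ) ^ (-u⁻¹) ≤ 2 ^ (-v⁻¹) := fun u v hu huv =>
    Real.rpow_le_rpow_of_exponent_le (by norm_num) (neg_le_neg (inv_anti₀ hu huv))
  have tl : ∀ u : ℕ → ℝ, Tendsto u atTop (𝓝 T) →
      Tendsto (fun j => (2:ℝ) ^ (-(u j)⁻¹)) atTop (𝓝 ((2:ℝ) ^ (-T⁻¹))) := fun u hu =>
    tendsto_const_nhds.rpow (hu.inv₀ h0.ne').neg (Or.inl (by norm_num))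
  refine ⟨⟨⟨fun z => a z.2, fun z => b z.2, by fun_prop, by fun_prop, fun z => (h _).2.1, fun z => (h _).2.2.1,
    fun x => ta⟩, ⟨fun z => c z.2, fun z => b z.2, by fun_prop, by fun_prop, fun z => (h _).2.1, fun z => (h _).2.2.2,
    fun x => tc⟩⟩, ?_⟩
  refine ⟨⟨fun z => xb (a z.2) (b z.2) (z.2 + 1), fun z => z.2 + 1,
    c_xb (by fun_prop) (by fun_prop) (by fun_prop), by fun_prop, fun z => Nat.succ_pos _, fun z => ?_, fun x => ?_⟩,
    ⟨fun z => xb (c z.2) (b z.2) (z.2 + 1) + 1, fun z => z.2 + 1,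
    c_succ (c_xb (by fun_prop) (by fun_prop) (by fun_prop)), by fun_prop, fun z => Nat.succ_pos _, fun z => ?_, fun x => ?_⟩⟩
  · exact (xb_spec _ _ _ (h _).1 (h _).2.1 (Nat.succ_pos _)).1.trans (mono _ _ (hapos _) (h _).2.2.1)
  · refine sq1 (fun j => (xb_spec _ _ _ (h j).1 (h j).2.1 (Nat.succ_pos _)).1) (fun j => ?_) (tl _ ta)
    have := (xb_spec _ _ (j+1) (h j).1 (h j).2.1 (Nat.succ_pos _)).2
    rwa [add_div] at this
  · have := (xb_spec (c z.2) (b z.2) (z.2 + 1) (hcp _) (h _).2.1 (Nat.succ_pos _)).2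
    push_cast at this ⊢
    exact (mono _ _ h0 (h _).2.2.2).trans this
  · refine sq2 (fun j => ?_) (fun j => ?_) (tl _ tc)
    · have := (xb_spec (c j) (b j) (j + 1) (hcp _) (h _).2.1 (Nat.succ_pos _)).2
      push_cast at this ⊢; exact this
    · have := (xb_spec (c j) (b j) (j + 1) (hcp _) (h _).2.1 (Nat.succ_pos _)).1
      push_cast at this ⊢; rw [add_div]; linarith

end EPR

namespace EPR

theorem summable_len (f : ℕ → ℝ) (h0 : ∀ n, 0 ≤ f n) (hf : Summable (fun n => 2 ^ n * f n)) :
    Summable (fun p : List Bool => f p.length) := by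
  rw [← (Equiv.sigmaFiberEquiv (List.length : List Bool → ℕ)).summable_iff]
  apply (summable_sigma_of_nonneg (fun x => h0 _)).2
  have e : ∀ n (y : {x : List Bool // x.length = n}),
      ((fun p : List Bool => f p.length) ∘ (Equiv.sigmaFiberEquiv (List.length : List Bool → ℕ))) ⟨n, y⟩ = f n := by
    rintro n ⟨y, hy⟩; simp [Equiv.sigmaFiberEquiv, hy]
  have fin : ∀ n, Finite {x : List Bool // x.length = n} := fun n =>
    inferInstanceAs (Finite (List.Vector Bool n))
  refine ⟨fun n => ?_, ?_⟩
  · have := fin n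
    exact Summable.of_finite
  · refine hf.congr (fun n => ?_)
    refine Eq.trans ?_ (tsum_congr (fun y => (e n y).symm))
    have : Fintype {x : List Bool // x.length = n} := inferInstanceAs (Fintype (List.Vector Bool n))
    rw [tsum_fintype, Finset.sum_const, nsmul_eq_mul]
    congr 1
    have : Fintype.card {x : List Bool // x.length = n} = 2 ^ n := by
      have := card_vector (α := Bool) n
      rw [Fintype.card_bool] at this
      rw [← this]; exact Fintype.card_congr (Equiv.refl _)
    rw [Finset.card_univ, this]; push_cast; rfl

theorem summable_geo {r : ℝ} (h0 : 0 ≤ r) (h1 : r < 1/2) :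
    Summable (fun p : List Bool => r ^ p.length) ∧
    Summable (fun p : List Bool => (p.length : ℝ) * r ^ p.length) := by
  have hr : ‖2 * r‖ < 1 := by rw [Real.norm_of_nonneg (by positivity)]; linarith
  constructor
  · apply summable_len (fun n => r ^ n) (fun n => by positivity)
    simp only [← mul_pow]
    exact summable_geometric_of_norm_lt_one hr
  · apply summable_len (fun n => n * r ^ n) (fun n => by positivity)
    have := summable_pow_mul_geometric_of_norm_lt_one 1 hr
    refine this.congr (fun n => ?_)
    rw [mul_pow]; ring

open Nat.Partrec (Code) in
theorem enum (V : Computer) : ∃ (act : ℕ → Bool) (prog out : ℕ → List Bool),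
    Computable act ∧ Computable prog ∧ Computable out ∧
    (∀ i, act i = true → out i ∈ V.f (prog i)) ∧
    (∀ q y, y ∈ V.f q → ∃ i, act i = true ∧ prog i = q ∧ out i = y) ∧
    (∀ i j, act i = true → act j = true → prog i = prog j → i = j) := by
  obtain ⟨c, hc⟩ := Code.exists_code.1 V.partrec
  have ev : ∀ (q y : List Bool), y ∈ V.f q ↔ Encodable.encode y ∈ c.eval (Encodable.encode q) := by
    intro q y
    rw [hc]
    simp
  have cev : Computable (fun z : ℕ × ℕ => Code.evaln z.1 c z.2) :=
    (Code.primrec_evaln.to_comp).comp (g := fun z : ℕ × ℕ => ((z.1, c), z.2)) 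
      (Computable.pair (Computable.pair Computable.fst (Computable.const c)) Computable.snd)
  let pr : ℕ → List Bool := fun n => (Encodable.decode n).getD []
  have cpr : Computable pr := Computable.option_getD Computable.decode (Computable.const _)
  have cpo : Computable (fun o : Option ℕ => pr (o.getD 0)) :=
    cpr.comp (Computable.option_getD Computable.id (Computable.const _))
  have cun : Computable Nat.unpair := Computable.unpair
  have cA : Computable (fun i : ℕ => Code.evaln i.unpair.2 c i.unpair.1) :=
    cev.comp (g := fun i : ℕ => (i.unpair.2, i.unpair.1)) (by fun_prop)
  have cB : Computable (fun i : ℕ => Code.evaln (i.unpair.2 + 1) c i.unpair.1) :=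
    cev.comp (g := fun i : ℕ => (i.unpair.2 + 1, i.unpair.1)) (by fun_prop)
  have cp : Computable (fun i : ℕ => pr i.unpair.1) := cpr.comp (g := fun i : ℕ => i.unpair.1) (by fun_prop)
  refine ⟨fun i => (!(Code.evaln i.unpair.2 c i.unpair.1).isSome) && ((Code.evaln (i.unpair.2 + 1) c i.unpair.1).isSome
      && decide (Encodable.encode (pr i.unpair.1) = i.unpair.1)), fun i => pr i.unpair.1,
    fun i => pr ((Code.evaln (i.unpair.2 + 1) c i.unpair.1).getD 0), ?_, cp, cpo.comp cB, ?_, ?_, ?_⟩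
  · exact c_and (c_not (c_isSome cA)) (c_and (c_isSome cB) (c_deq (c_encode cp) (by fun_prop)))
  · intro i hi
    simp only [Bool.and_eq_true, decide_eq_true_eq] at hi
    obtain ⟨h1, h2, h3⟩ := hi
    obtain ⟨v, hv⟩ := Option.isSome_iff_exists.1 h2
    have hs := Code.evaln_sound hv
    have hs2 := hs
    rw [← h3, hc] at hs
    simp at hs
    obtain ⟨y, hy, hy2⟩ := hs
    beta_reduce
    rw [hv]
    simp only [Option.getD_some, pr]
    rw [← hy2, Encodable.encodek]
    exact hy
  · intro q y hy
    rw [ev] at hy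
    obtain ⟨k, hk⟩ := Code.evaln_complete.1 hy
    let P : ℕ → Prop := fun k => (Code.evaln k c (Encodable.encode q)).isSome = true
    have hex : ∃ k, P k := ⟨k, Option.isSome_iff_exists.2 ⟨_, hk⟩⟩
    classical
    have hP := Nat.find_spec hex
    have hm : ∀ m < Nat.find hex, ¬ P m := fun m hm => Nat.find_min hex hm
    generalize Nat.find hex = k0 at hP hm
    cases k0 with
    | zero => simp [P, Code.evaln] at hP
    | succ k1 =>
      refine ⟨Nat.pair (Encodable.encode q) k1, ?_, ?_, ?_⟩
      · simp only [Nat.unpair_pair, Bool.and_eq_true, decide_eq_true_eq]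
        refine ⟨?_, hP, by simp [pr]⟩
        have := hm k1 (Nat.lt_succ_self _)
        simpa [P] using this
      · simp [pr]
      · simp only [Nat.unpair_pair]
        obtain ⟨v, hv⟩ := Option.isSome_iff_exists.1 hP
        have hs := Code.evaln_sound hv
        have := Part.mem_unique hs hy
        rw [hv, this]; simp [pr]
  · intro i j hi hj hij
    simp only [Bool.and_eq_true, decide_eq_true_eq] at hi hj
    obtain ⟨h1, h2, h3⟩ := hi
    obtain ⟨g1, g2, g3⟩ := hj
    have hn : i.unpair.1 = j.unpair.1 := by rw [← h3, ← g3]; exact congrArg _ hij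
    have mono : ∀ n k k', (Code.evaln (k + 1) c n).isSome = true → k < k' → (Code.evaln k' c n).isSome = true := by
      intro n k k' h hk
      obtain ⟨v, hv⟩ := Option.isSome_iff_exists.1 h
      have := Code.evaln_mono (show k + 1 ≤ k' from hk) hv
      rw [show Code.evaln k' c n = some v from this]; rfl
    have hk : i.unpair.2 = j.unpair.2 := by
      rcases lt_trichotomy i.unpair.2 j.unpair.2 with h | h | h
      · have := mono _ _ _ h2 h
        rw [hn] at this; simp [this] at g1
      · exact h
      · have := mono _ _ _ g2 h
        rw [← hn] at this; simp [this] at h1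
    rw [← Nat.pair_unpair i, ← Nat.pair_unpair j, hn, hk]

theorem enum_sum (V : Computer) {act : ℕ → Bool} {prog out : ℕ → List Bool} 
    (h1 : ∀ i, act i = true → out i ∈ V.f (prog i))
    (h2 : ∀ q y, y ∈ V.f q → ∃ i, act i = true ∧ prog i = q ∧ out i = y)
    (h3 : ∀ i j, act i = true → act j = true → prog i = prog j → i = j) (g : List Bool → ℝ) (s : ℝ) :
    HasSum (fun i => if act i = true then g (prog i) else 0) s ↔ HasSum (fun p : V.f.Dom => g p.1) s := by
  have h4 : ∀ p : V.f.Dom, ∃ i, act i = true ∧ prog i = p.1 := by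
    rintro ⟨p, hp⟩
    obtain ⟨y, hy⟩ := Part.dom_iff_mem.1 hp
    obtain ⟨i, a, b, _⟩ := h2 p y hy
    exact ⟨i, a, b⟩
  choose idx ha hb using h4
  have inj : Function.Injective idx := by
    intro p q h
    apply Subtype.ext
    rw [← hb p, ← hb q, h]
  rw [← inj.hasSum_iff]
  · apply iff_of_eq; congr 1; funext p; simp [ha, hb]
  · intro i hi
    rw [if_neg]
    intro hact
    apply hi
    refine ⟨⟨prog i, Part.dom_iff_mem.2 ⟨_, h1 i hact⟩⟩, ?_⟩
    exact h3 _ _ (ha _) hact (hb _)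

end EPR

namespace EPR

theorem step_bounds {T A z w l WA W Z z0 : ℝ} {c : ℕ} (hT : 0 < T) (hz0 : 0 < z0) (hA : z0 ≤ A) (hz : 0 ≤ z)
    (hw : w = l * z) (hl : z = 0 ∨ (1 ≤ l ∧ 2 * W / z0 ≤ l)) (hWA : 0 ≤ WA) (hW : WA ≤ W) (hZ : A + z ≤ Z) :
    (2 * T * Z)⁻¹ * w ≤ (T⁻¹ * ((WA + w) * (A + z)⁻¹) + Real.logb 2 (2 ^ c * (A + z)))
      - (T⁻¹ * (WA * A⁻¹) + Real.logb 2 (2 ^ c * A)) ∧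
    (T⁻¹ * ((WA + w) * (A + z)⁻¹) + Real.logb 2 (2 ^ c * (A + z)))
      - (T⁻¹ * (WA * A⁻¹) + Real.logb 2 (2 ^ c * A)) ≤ (T⁻¹ * z0⁻¹ + z0⁻¹ * (Real.log 2)⁻¹) * w := by
  have Ap : 0 < A := by linarith
  have Bp : 0 < A + z := by linarith
  have Zp : 0 < Z := by linarith
  have l2 : 0 < Real.log 2 := Real.log_pos (by norm_num)
  have hl1 : z ≤ w := by
    rcases hl with h | ⟨h, _⟩
    · rw [hw, h]; simp
    · rw [hw]; nlinarith
  have hw0 : 0 ≤ w := le_trans hz hl1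
  have hl2 : WA * z ≤ A * w / 2 := by
    rcases hl with h | ⟨_, h⟩
    · rw [hw, h]; simp
    · rw [div_le_iff₀ hz0] at h
      rw [hw]
      have : 2 * WA ≤ l * A := by
        have : 0 ≤ l := by
          by_contra hn
          have : l * z0 < 0 := mul_neg_of_neg_of_pos (not_le.1 hn) hz0
          linarith
        nlinarith
      nlinarith
  have e1 : (WA + w) * (A + z)⁻¹ - WA * A⁻¹ = (A * w - WA * z) / (A * (A + z)) := by
    field_simp; ring
  have e2 : Real.logb 2 (2 ^ c * (A + z)) - Real.logb 2 (2 ^ c * A) = Real.log ((A + z) / A) / Real.log 2 := by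
    rw [← Real.logb_div (by positivity) (by positivity), mul_div_mul_left _ _ (by positivity), Real.logb]
  have e3 : (T⁻¹ * ((WA + w) * (A + z)⁻¹) + Real.logb 2 (2 ^ c * (A + z)))
      - (T⁻¹ * (WA * A⁻¹) + Real.logb 2 (2 ^ c * A)) =
      T⁻¹ * ((A * w - WA * z) / (A * (A + z))) + Real.log ((A + z) / A) / Real.log 2 := by
    rw [← e1, ← e2]; ring
  rw [e3]
  have g1 : 0 ≤ Real.log ((A + z) / A) := Real.log_nonneg (by rw [le_div_iff₀ Ap]; linarith)
  have g2 : Real.log ((A + z) / A) ≤ z / A := by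
    have := Real.log_le_sub_one_of_pos (show 0 < (A + z) / A by positivity)
    rw [show (A + z) / A - 1 = z / A by field_simp; ring] at this
    exact this
  constructor
  · have : (2 * T * Z)⁻¹ * w ≤ T⁻¹ * ((A * w - WA * z) / (A * (A + z))) := by
      calc (2 * T * Z)⁻¹ * w ≤ (2 * T * (A + z))⁻¹ * w := by gcongr
        _ = T⁻¹ * ((A * w / 2) / (A * (A + z))) := by field_simp
        _ ≤ _ := by gcongr; linarith
    have := div_nonneg g1 l2.le
    linarith
  · have h1 : T⁻¹ * ((A * w - WA * z) / (A * (A + z))) ≤ T⁻¹ * z0⁻¹ * w := by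
      calc T⁻¹ * ((A * w - WA * z) / (A * (A + z))) ≤ T⁻¹ * ((A * w) / (A * (A + z))) := by
            gcongr; nlinarith [mul_nonneg hWA hz]
        _ = T⁻¹ * (A + z)⁻¹ * w := by field_simp
        _ ≤ _ := by gcongr; linarith
    have h2 : Real.log ((A + z) / A) / Real.log 2 ≤ z0⁻¹ * (Real.log 2)⁻¹ * w := by
      calc Real.log ((A + z) / A) / Real.log 2 ≤ (z / A) / Real.log 2 := by gcongr
        _ = A⁻¹ * (Real.log 2)⁻¹ * z := by field_simp
        _ ≤ _ := by gcongr
    linarith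

theorem analysis {T : ℝ} (hT : 0 < T) {z l : ℕ → ℝ} (hz : ∀ i, 0 ≤ z i) (hl : ∀ i, 0 ≤ l i)
    {Z W : ℝ} (hZ : HasSum z Z) (hW : HasSum (fun i => l i * z i) W)
    (hL : ∀ L : ℝ, ∃ K, ∀ i ≥ K, z i = 0 ∨ L ≤ l i) (h0 : ∃ i, 0 < z i) :
    ∃ (k0 c : ℕ) (c1 c2 : ℝ) (X : ℕ → ℝ), 0 < c1 ∧ 0 < c2 ∧ 0 < Z ∧
      (∀ k, X k = T⁻¹ * ((∑ i ∈ Finset.range (k + k0), l i * z i) * (∑ i ∈ Finset.range (k + k0), z i)⁻¹)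
        + Real.logb 2 (2 ^ c * ∑ i ∈ Finset.range (k + k0), z i)) ∧
      (∀ k, 1 ≤ 2 ^ c * ∑ i ∈ Finset.range (k + k0), z i) ∧
      (∀ k, c1 * (l (k + k0) * z (k + k0)) ≤ X (k + 1) - X k) ∧
      (∀ k, X (k + 1) - X k ≤ c2 * (l (k + k0) * z (k + k0))) ∧
      (∀ k, z (k + k0) = 0 ∨ 1 ≤ l (k + k0)) ∧
      Tendsto X atTop (𝓝 (T⁻¹ * (W * Z⁻¹) + Real.logb 2 (2 ^ c * Z))) := by
  obtain ⟨i0, hi0⟩ := h0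
  set z0 := z i0 with hz0
  obtain ⟨K, hK⟩ := hL (max 1 (2 * W / z0))
  obtain ⟨c, hc⟩ := pow_unbounded_of_one_lt (z0⁻¹) (show (1:ℝ) < 2 by norm_num)
  set k0 := max K (i0 + 1) with hk0
  have hA : ∀ k, z0 ≤ ∑ i ∈ Finset.range (k + k0), z i := fun k =>
    Finset.single_le_sum (f := z) (fun i _ => hz i) (Finset.mem_range.2 (by omega))
  have hlz : ∀ i, 0 ≤ l i * z i := fun i => mul_nonneg (hl i) (hz i)
  have hZle : ∀ k, ∑ i ∈ Finset.range k, z i ≤ Z := fun k => sum_le_hasSum _ (fun i _ => hz i) hZ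
  have hWle : ∀ k, ∑ i ∈ Finset.range k, l i * z i ≤ W := fun k => sum_le_hasSum _ (fun i _ => hlz i) hW
  have Zp : 0 < Z := lt_of_lt_of_le hi0 ((hA 0).trans (hZle _))
  have l2 : 0 < Real.log 2 := Real.log_pos (by norm_num)
  let X : ℕ → ℝ := fun k => T⁻¹ * ((∑ i ∈ Finset.range (k + k0), l i * z i) * (∑ i ∈ Finset.range (k + k0), z i)⁻¹)
        + Real.logb 2 (2 ^ c * ∑ i ∈ Finset.range (k + k0), z i)
  have st : ∀ k, _ := fun k => step_bounds (T := T) (A := ∑ i ∈ Finset.range (k + k0), z i) (z := z (k + k0))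
    (w := l (k + k0) * z (k + k0)) (l := l (k + k0)) (WA := ∑ i ∈ Finset.range (k + k0), l i * z i) (W := W) (Z := Z)
    (z0 := z0) (c := c) hT hi0 (hA k) (hz _) rfl
    (by
      rcases hK (k + k0) (by omega) with h | h
      · exact Or.inl h
      · exact Or.inr ⟨(le_max_left _ _).trans h, (le_max_right _ _).trans h⟩)
    (Finset.sum_nonneg (fun i _ => hlz i)) (hWle _) (by rw [← Finset.sum_range_succ]; exact hZle _)
  have X1 : ∀ k, X (k + 1) = (T⁻¹ * ((∑ i ∈ Finset.range (k + k0), l i * z i + l (k + k0) * z (k + k0)) *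
      (∑ i ∈ Finset.range (k + k0), z i + z (k + k0))⁻¹)
        + Real.logb 2 (2 ^ c * (∑ i ∈ Finset.range (k + k0), z i + z (k + k0)))) := by
    intro k
    simp only [X]
    rw [show k + 1 + k0 = (k + k0) + 1 by ring, Finset.sum_range_succ, Finset.sum_range_succ]
  refine ⟨k0, c, (2 * T * Z)⁻¹, T⁻¹ * z0⁻¹ + z0⁻¹ * (Real.log 2)⁻¹, X, by positivity, by positivity, Zp,
    fun k => rfl, fun k => ?_, fun k => ?_, fun k => ?_,
    fun k => (hK (k + k0) (by omega)).imp id (fun h => (le_max_left _ _).trans h), ?_⟩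
  · have := hA k
    calc (1:ℝ) = z0⁻¹ * z0 := by rw [inv_mul_cancel₀ hi0.ne']
      _ ≤ _ := by gcongr
  · rw [X1]; exact (st k).1
  · rw [X1]; exact (st k).2
  · have tz := (tendsto_add_atTop_iff_nat k0).2 hZ.tendsto_sum_nat
    have tw := (tendsto_add_atTop_iff_nat k0).2 hW.tendsto_sum_nat
    refine ((tw.mul (tz.inv₀ Zp.ne')).const_mul _).add ?_
    exact (Real.continuousAt_logb (x := 2 ^ c * Z) (by positivity)).tendsto.comp (tz.const_mul _)

/-- Everything that is used about `V` and `T` afterwards. -/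
theorem setup (V : Computer) {T : ℝ} (h0 : 0 < T) (h1 : T < 1) (hT : ComputableReal T) :
    Summable (fun p : V.f.Dom => boltzmann T p.1) ∧
    Summable (fun p : V.f.Dom => (p.1.length : ℝ) * boltzmann T p.1) ∧
    ∃ (act : ℕ → Bool) (prog out : ℕ → List Bool) (k0 c : ℕ) (c1 c2 : ℝ) (X : ℕ → ℝ) (m : ℕ × ℕ → ℕ),
      Computable act ∧ Computable prog ∧ Computable out ∧ Computable m ∧
      (∀ i, act i = true → out i ∈ V.f (prog i)) ∧
      (∀ q y, y ∈ V.f q → ∃ i, act i = true ∧ prog i = q ∧ out i = y) ∧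
      (∀ i j, act i = true → act j = true → prog i = prog j → i = j) ∧
      0 < c1 ∧ 0 < c2 ∧ (∀ k, 0 ≤ X k) ∧
      (∀ k n, |(m (k, n) : ℝ) - 2 ^ n * X k| ≤ 1) ∧
      (∀ k, c1 * (if act (k + k0) = true then ((prog (k + k0)).length : ℝ) * boltzmann T (prog (k + k0)) else 0)
        ≤ X (k + 1) - X k) ∧
      (∀ k, X (k + 1) - X k ≤
        c2 * (if act (k + k0) = true then ((prog (k + k0)).length : ℝ) * boltzmann T (prog (k + k0)) else 0)) ∧
      (∀ k, act (k + k0) = true → 1 ≤ (prog (k + k0)).length) ∧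
      Tendsto X atTop (𝓝 (Sfun V T + c)) := by
  set β : ℝ := (2:ℝ) ^ (-T⁻¹) with hβ
  have bp : 0 < β := by positivity
  have bh : β < 1/2 := by
    have : β < (2:ℝ) ^ (-1:ℝ) := by
      apply Real.rpow_lt_rpow_of_exponent_lt (by norm_num)
      have := (one_lt_inv₀ h0).2 h1
      linarith
    rw [Real.rpow_neg_one] at this; linarith
  have bz : ∀ p, boltzmann T p = β ^ p.length := by
    intro p
    rw [boltzmann, hβ, ← Real.rpow_natCast, ← Real.rpow_mul (by norm_num)]
    congr 1; rw [div_eq_mul_inv]; ring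
  obtain ⟨s1, s2⟩ := summable_geo bp.le bh
  have S1 : Summable (fun p : V.f.Dom => boltzmann T p.1) := by
    simp only [bz]; exact s1.comp_injective Subtype.val_injective
  have S2 : Summable (fun p : V.f.Dom => (p.1.length : ℝ) * boltzmann T p.1) := by
    simp only [bz]; exact s2.comp_injective Subtype.val_injective
  refine ⟨S1, S2, ?_⟩
  obtain ⟨act, prog, out, ca, cp, co, e1, e2, e3⟩ := enum V
  have HZ := (enum_sum V e1 e2 e3 (fun p => boltzmann T p) _).2 S1.hasSum
  have HW := (enum_sum V e1 e2 e3 (fun p => (p.length:ℝ) * boltzmann T p) _).2 S2.hasSum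
  set z : ℕ → ℝ := fun i => if act i = true then boltzmann T (prog i) else 0 with hzdef
  set l : ℕ → ℝ := fun i => ((prog i).length : ℝ) with hldef
  have lz : ∀ i, (if act i = true then ((prog i).length : ℝ) * boltzmann T (prog i) else 0) = l i * z i := by
    intro i; simp only [z, l]; split_ifs <;> simp
  have HW' : HasSum (fun i => l i * z i) (∑' p : V.f.Dom, (p.1.length : ℝ) * boltzmann T p.1) := by
    simpa only [lz] using HW
  have hz : ∀ i, 0 ≤ z i := by
    intro i; simp only [z, bz]; split_ifs <;> positivity
  have hl : ∀ i, 0 ≤ l i := fun i => Nat.cast_nonneg _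
  have hL : ∀ L : ℝ, ∃ K, ∀ i ≥ K, z i = 0 ∨ L ≤ l i := by
    intro L
    obtain ⟨N, hN⟩ := exists_nat_ge L
    have := HZ.summable.tendsto_atTop_zero.eventually_lt_const (show 0 < β ^ N by positivity)
    obtain ⟨K, hK⟩ := eventually_atTop.1 this
    refine ⟨K, fun i hi => ?_⟩
    have h := hK i hi
    by_cases ha : act i = true
    · right
      simp only [z, if_pos ha, bz] at h
      have := (pow_lt_pow_iff_right_of_lt_one₀ bp (by linarith)).1 h
      refine hN.trans ?_
      simp only [l]; exact_mod_cast this.le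
    · left; simp [z, ha]
  have h00 : ∃ i, 0 < z i := by
    obtain ⟨p, hp⟩ := V.dom_nonempty
    obtain ⟨y, hy⟩ := Part.dom_iff_mem.1 hp
    obtain ⟨i, a, b, _⟩ := e2 p y hy
    refine ⟨i, ?_⟩
    simp only [z, if_pos a, bz]; positivity
  obtain ⟨k0, c, c1, c2, X, hc1, hc2, Zp, hX, hone, hs1, hs2, hs3, ht⟩ := analysis h0 hz hl HZ HW' hL h00
  have nn : ∀ k, 0 ≤ X k := by
    intro k
    rw [hX]
    have a1 : 0 ≤ Real.logb 2 (2 ^ c * ∑ i ∈ Finset.range (k + k0), z i) := Real.logb_nonneg (by norm_num) (hone k)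
    have a2 : 0 ≤ ∑ i ∈ Finset.range (k + k0), l i * z i := Finset.sum_nonneg (fun i _ => mul_nonneg (hl i) (hz i))
    have a3 : 0 ≤ ∑ i ∈ Finset.range (k + k0), z i := Finset.sum_nonneg (fun i _ => (hz i))
    positivity
  have crz : CR z := by
    have cl : Computable (fun i => if act i = true then 1 else 0) :=
      c_ite (c_deq ca (c_const true)) (c_const 1) (c_const 0)
    have := ((CR.nat cl).mul ((CR.temp (α := ℕ) h0 hT).2.pow (c_len cp) (fun _ => bp.le)) (fun _ => by positivity)
      (fun _ => by positivity))
    convert this using 2 with i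
    simp only [z, bz]; split_ifs <;> simp [hβ]
  have crlz : CR (fun i => l i * z i) := (CR.nat (c_len cp)).mul crz hl hz
  have crZ : CR (fun k => ∑ i ∈ Finset.range (k + k0), z i) := crz.sum.comp (g := fun k => k + k0) (by fun_prop)
  have crW : CR (fun k => ∑ i ∈ Finset.range (k + k0), l i * z i) := crlz.sum.comp (g := fun k => k + k0) (by fun_prop)
  obtain ⟨Tn, hTn⟩ := exists_nat_gt (T⁻¹)
  have Tn0 : 0 < Tn := by
    have : (0:ℝ) < Tn := lt_trans (by positivity) hTn
    exact_mod_cast this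
  have crX : CR X := by
    have t1 : CR (fun _ : ℕ => T⁻¹) := (CR.temp (α := ℕ) h0 hT).1.inv Tn Tn0 (fun _ => by
      rw [one_div]; exact inv_le_of_inv_le₀ h0 hTn.le)
    have t2 : CR (fun k => (∑ i ∈ Finset.range (k + k0), z i)⁻¹) := crZ.inv (2 ^ c) (by positivity) (fun k => by
      rw [div_le_iff₀ (by positivity), mul_comm]; exact_mod_cast hone k)
    have t3 : CR (fun k => 2 ^ c * ∑ i ∈ Finset.range (k + k0), z i) := by
      have := (CR.nat (α := ℕ) (c_const (2 ^ c))).mul crZ (fun _ => by positivity) (fun k => Finset.sum_nonneg (fun i _ => (hz i)))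
      convert this using 3; push_cast; rfl
    have := (t1.mul (crW.mul t2 (fun k => Finset.sum_nonneg (fun i _ => mul_nonneg (hl i) (hz i)))
      (fun k => inv_nonneg.2 (Finset.sum_nonneg (fun i _ => (hz i))))) (fun _ => by positivity)
      (fun k => mul_nonneg (Finset.sum_nonneg (fun i _ => mul_nonneg (hl i) (hz i)))
        (inv_nonneg.2 (Finset.sum_nonneg (fun i _ => (hz i)))))).add (t3.log hone)
    convert this using 2 with k
    exact hX k
  obtain ⟨m, cm, hm⟩ := crX.approx nn
  refine ⟨act, prog, out, k0, c, c1, c2, X, m, ca, cp, co, cm, e1, e2, e3, hc1, hc2, nn, hm, ?_, ?_, ?_, ?_⟩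
  · simp only [lz]; exact hs1
  · simp only [lz]; exact hs2
  · intro k hk
    rcases hs3 k with h | h
    · simp only [z, if_pos hk, bz] at h
      exact absurd h (by positivity)
    · simp only [l] at h; exact_mod_cast h
  · convert ht using 2
    have zz : Zfun V T = ∑' p : V.f.Dom, boltzmann T p.1 := rfl
    rw [Real.logb_mul (by positivity) Zp.ne', Real.logb_pow, Real.logb_self_eq_one (by norm_num)]
    rw [Sfun, Efun, Ffun, zz]
    field_simp
    ring

end EPR

namespace EPR

def val (s : List Bool) : ℕ := s.foldl (fun a b => 2 * a + b.toNat) 0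

theorem c_val : Computable val := by
  have : Primrec val := by
    refine Primrec.list_foldl (f := fun s : List Bool => s) (g := fun _ => 0)
      (h := fun _ z => 2 * z.1 + z.2.toNat) Primrec.id (Primrec.const 0) ?_
    have h1 : Primrec (fun b : Bool => b.toNat) := Primrec.dom_finite _
    exact Primrec.nat_add.comp (Primrec.nat_mul.comp (Primrec.const 2) (Primrec.fst.comp Primrec.snd))
      (h1.comp (Primrec.snd.comp Primrec.snd))
  exact this.to_comp

theorem val_append (s : List Bool) (b : Bool) : val (s ++ [b]) = 2 * val s + b.toNat := by
  simp [val, List.foldl_append]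

theorem val_lt (s : List Bool) : val s < 2 ^ s.length := by
  induction s using List.reverseRecOn with
  | nil => simp [val]
  | append_singleton s b ih =>
    rw [val_append, List.length_append, List.length_singleton, pow_succ]
    have : b.toNat ≤ 1 := by cases b <;> simp
    omega

theorem val_inj {s t : List Bool} (h : s.length = t.length) (hv : val s = val t) : s = t := by
  induction s using List.reverseRecOn generalizing t with
  | nil => simp at h; exact (List.length_eq_zero_iff.1 h.symm).symm
  | append_singleton s b ih =>
    rcases List.eq_nil_or_concat t with rfl | ⟨t', b', rfl⟩
    · simp at h
    · rw [List.concat_eq_append] at *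
      rw [val_append, val_append] at hv
      have hb : b = b' ∧ val s = val t' := by
        cases b <;> cases b' <;> simp at hv ⊢ <;> omega
      rw [hb.1, ih (by simpa using h) hb.2]

theorem val_surj (n N : ℕ) (h : N < 2 ^ n) : ∃ s : List Bool, s.length = n ∧ val s = N := by
  induction n generalizing N with
  | zero => exact ⟨[], rfl, by simp [val]; simp at h; omega⟩
  | succ n ih =>
    obtain ⟨s, h1, h2⟩ := ih (N / 2) (by rw [pow_succ] at h; omega)
    refine ⟨s ++ [decide (N % 2 = 1)], by simp [h1], ?_⟩
    rw [val_append, h2]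
    rcases Nat.mod_two_eq_zero_or_one N with h | h <;> simp [h] <;> omega

/-- the computable inverse of `val` -/
theorem exists_bits : ∃ B : ℕ × ℕ → List Bool, Computable B ∧ ∀ z, (B z).length = z.1 ∧ val (B z) = z.2 % 2 ^ z.1 := by
  let pr : ℕ → List Bool := fun n => (Encodable.decode n).getD []
  have cpr : Computable pr := Computable.option_getD Computable.decode (Computable.const _)
  have cv := c_val
  have e : ∀ p : List Bool, pr (Encodable.encode p) = p := by intro p; simp [pr]
  generalize pr = pr at cpr e
  have e' : ∀ p : List Bool, val p < 2 ^ p.length := val_lt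
  have e2 := val_surj
  generalize val = v at cv e' e2
  obtain ⟨f, hf, hf2⟩ := c_search (α := ℕ × ℕ)
    (R := fun z => decide ((pr z.2).length = z.1.1 ∧ v (pr z.2) = z.1.2 % 2 ^ z.1.1)) (by fun_prop) (by
      rintro ⟨n, N⟩
      obtain ⟨s, h1, h2⟩ := e2 n (N % 2 ^ n) (Nat.mod_lt _ (by positivity))
      exact ⟨Encodable.encode s, decide_eq_true (by rw [e]; exact ⟨h1, h2⟩)⟩)
  exact ⟨fun z => pr (f z), by fun_prop, fun z => of_decide_eq_true (hf2 z)⟩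

theorem val_firstBits (a : ℝ) (n : ℕ) : (val (firstBits a n) : ℤ) = ⌊(a - ⌊a⌋) * 2 ^ n⌋ := by
  induction n with
  | zero => simp [firstBits, val]
  | succ n ih =>
    have : firstBits a (n + 1) = firstBits a n ++ [bitOf a n] := by
      simp [firstBits, List.range_succ]
    rw [this, val_append]
    push_cast
    rw [ih]
    have h2 : ⌊(a - ⌊a⌋) * 2 ^ n⌋ = ⌊(a - ⌊a⌋) * 2 ^ (n+1)⌋ / 2 := by
      have := Int.floor_div_natCast ((a - ⌊a⌋) * 2 ^ (n+1)) 2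
      push_cast at this
      rw [← this]; congr 1; rw [pow_succ]; field_simp
    rw [h2, bitOf]
    generalize ⌊(a - ⌊a⌋) * 2 ^ (n+1)⌋ = y
    rcases Int.emod_two_eq_zero_or_one y with h | h <;> simp [h] <;> omega

theorem length_firstBits (a : ℝ) (n : ℕ) : (firstBits a n).length = n := by simp [firstBits]

/-- relation between the bits of `a` and the integer part of `2^n (a + c)`. -/
theorem floor_bits (a : ℝ) (c n : ℕ) (h : 0 ≤ a + c) :
    ⌊2 ^ n * (a + c)⌋₊ = val (firstBits a n) + 2 ^ n * ⌊a + c⌋₊ := by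
  have h1 := val_firstBits a n
  zify
  rw [Int.natCast_floor_eq_floor (by positivity), Int.natCast_floor_eq_floor h, h1]
  rw [Int.floor_add_natCast]
  have : (2:ℝ) ^ n * (a + c) = (a - ⌊a⌋) * 2 ^ n + ((2 ^ n * (⌊a⌋ + c) : ℤ) : ℝ) := by push_cast; ring
  rw [this, Int.floor_add_intCast]

theorem exists_prog {U : Computer} (hU : Optimal U) (s : List Bool) :
    ∃ p, s ∈ U.f p ∧ p.length = complexity U s := by
  let C : Computer := ⟨fun p => bif decide (p = []) then Part.some s else Part.none, by
      refine Partrec.cond (c_deq c_id (c_const _)) (Computable.const s) Partrec.none,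
    ⟨[], by simp [PFun.Dom]⟩, by
      intro p hp q hq _
      have : ∀ p, p ∈ PFun.Dom (fun p : List Bool => bif decide (p = []) then Part.some s else Part.none) → p = [] := by
        intro p hp
        by_contra hne
        simp [PFun.Dom, hne] at hp
      rw [this p hp, this q hq]⟩
  obtain ⟨d, hd⟩ := hU C
  obtain ⟨q, hq, _⟩ := hd [] (by simp [C, PFun.Dom])
  have : (complexity U s) ∈ {n | ∃ p : List Bool, s ∈ U.f p ∧ p.length = n} :=
    Nat.sInf_mem ⟨q.length, q, by rw [hq]; simp [C], rfl⟩
  exact this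

theorem real_growth {T C : ℝ} (hT : 0 < T) (hC : 0 < C) (l : ℕ → ℕ) (h1 : ∀ n, 1 ≤ l n)
    (h : ∀ n, (l n : ℝ) * (2:ℝ) ^ (-(l n : ℝ) / T) ≤ C * 2 ^ (-(n:ℝ))) :
    Tendsto (fun n => (l n : ℝ) - T * n) atTop atTop := by
  have key : ∀ n, T * Real.logb 2 (l n) - T * Real.logb 2 C ≤ l n - T * n := by
    intro n
    have hl : (0:ℝ) < l n := by exact_mod_cast h1 n
    have := Real.logb_le_logb_of_le (b := 2) (by norm_num) (by positivity) (h n)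
    rw [Real.logb_mul hl.ne' (by positivity), Real.logb_mul hC.ne' (by positivity),
      Real.logb_rpow (by norm_num) (by norm_num), Real.logb_rpow (by norm_num) (by norm_num)] at this
    have h3 := mul_le_mul_of_nonneg_left this hT.le
    have e : T * (Real.logb 2 (l n) + -(l n : ℝ) / T) = T * Real.logb 2 (l n) - l n := by field_simp; ring
    rw [e] at h3
    linarith
  have lg0 : ∀ n, 0 ≤ Real.logb 2 (l n) := fun n => Real.logb_nonneg (by norm_num) (by exact_mod_cast h1 n)
  have t1 : Tendsto (fun n => (l n : ℝ)) atTop atTop := by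
    refine tendsto_atTop_mono (f := fun n : ℕ => T * n + (- T * Real.logb 2 C)) (fun n => ?_) ?_
    · have := key n
      have := mul_nonneg hT.le (lg0 n)
      linarith
    · exact tendsto_atTop_add_const_right _ _ ((tendsto_natCast_atTop_atTop).const_mul_atTop hT)
  refine tendsto_atTop_mono (f := fun n : ℕ => T * Real.logb 2 (l n) + (- T * Real.logb 2 C)) (fun n => ?_) ?_
  · have := key n; linarith
  · exact tendsto_atTop_add_const_right _ _
      (((Real.tendsto_logb_atTop (by norm_num)).comp t1).const_mul_atTop hT)

end EPR

namespace EPR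

def yrec (out : ℕ → List Bool) (k : ℕ) : List Bool :=
  Nat.rec (motive := fun _ => List Bool) [true] (fun i s => out i ++ s) k

theorem c_yrec {out : ℕ → List Bool} (h : Computable out) : Computable (yrec out) := by
  unfold yrec
  refine c_natrec (f := fun k : ℕ => k) (g := fun _ => [true]) (h := fun _ i s => out i ++ s)
    c_id (c_const _) ?_
  exact Computable.list_append.comp (h.comp (Computable.fst.comp Computable.snd)) (Computable.snd.comp Computable.snd)

theorem yrec_len (out : ℕ → List Bool) (k i : ℕ) (h : i < k) : (out i).length < (yrec out k).length := by
  induction k with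
  | zero => omega
  | succ k ih =>
    have e : yrec out (k + 1) = out k ++ yrec out k := rfl
    have pos : ∀ k, 0 < (yrec out k).length := by
      intro k
      induction k with
      | zero => simp [yrec]
      | succ k ih =>
        have e : yrec out (k + 1) = out k ++ yrec out k := rfl
        rw [e, List.length_append]; omega
    rw [e, List.length_append]
    rcases Nat.lt_succ_iff_lt_or_eq.1 h with h | h
    · have := ih h; omega
    · subst h; have := pos i; omega

theorem partA (U V : Computer) (hU : Optimal U) (hV : Optimal V) {T S : ℝ} (h0 : 0 < T)
    {act : ℕ → Bool} {prog out : ℕ → List Bool} {k0 c : ℕ} {c1 : ℝ} {X : ℕ → ℝ} {m : ℕ × ℕ → ℕ}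
    (co : Computable out) (cm : Computable m)
    (e2 : ∀ q y, y ∈ V.f q → ∃ i, act i = true ∧ prog i = q ∧ out i = y)
    (hc1 : 0 < c1) (nn : ∀ k, 0 ≤ X k)
    (hm : ∀ k n, |(m (k, n) : ℝ) - 2 ^ n * X k| ≤ 1)
    (hs : ∀ k, c1 * (if act (k + k0) = true then ((prog (k + k0)).length : ℝ) * boltzmann T (prog (k + k0)) else 0)
        ≤ X (k + 1) - X k)
    (hl : ∀ k, act (k + k0) = true → 1 ≤ (prog (k + k0)).length)
    (ht : Tendsto X atTop (𝓝 (S + c))) : ChaitinTRandom U T S := by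
  have mono : Monotone X := by
    refine monotone_nat_of_le_succ (fun k => ?_)
    have := hs k
    have h : 0 ≤ c1 * (if act (k + k0) = true then ((prog (k + k0)).length : ℝ) * boltzmann T (prog (k + k0)) else 0) := by
      split_ifs
      · unfold boltzmann; positivity
      · simp
    linarith
  have le : ∀ k, X k ≤ S + c := fun k => mono.ge_of_tendsto ht k
  have x0 : 0 ≤ S + c := (nn 0).trans (le 0)
  set I := ⌊S + c⌋₊ with hI
  have cv := c_val
  obtain ⟨F, pF, F1, F2⟩ := p_search (α := List Bool)
    (R := fun z => decide (val z.1 + 2 ^ z.1.length * I ≤ m (z.2, z.1.length) + 4)) (by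
      generalize val = v at cv
      fun_prop)
  have Y := c_yrec co
  have pG : Partrec (fun s : List Bool => (F s).map (fun k => yrec out (k + k0))) :=
    pF.map ((Y.comp (g := fun z : List Bool × ℕ => z.2 + k0) (by fun_prop)).to₂)
  -- existence and quality of the search
  have Fex : ∀ n, ∃ k, k ∈ F (firstBits S n) := by
    intro n
    have p2 : (0:ℝ) < 2 ^ n := by positivity
    have := (ht.const_mul (2 ^ n)).eventually_const_lt (show 2 ^ n * (S + c) - 1 < 2 ^ n * (S + c) by linarith)
    obtain ⟨k, hk⟩ := this.exists
    refine F2 _ k (decide_eq_true ?_)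
    rw [length_firstBits, ← floor_bits S c n x0]
    have a1 := Nat.floor_le (show 0 ≤ 2 ^ n * (S + c) by positivity)
    have a2 := (abs_le.1 (hm k n)).1
    have : ((⌊2 ^ n * (S + c)⌋₊ : ℕ) : ℝ) ≤ m (k, n) + 4 := by linarith
    exact_mod_cast this
  have Fq : ∀ n k, k ∈ F (firstBits S n) → 2 ^ n * (S + c - X k) ≤ 6 := by
    intro n k hk
    have := of_decide_eq_true (F1 _ _ hk)
    simp only at this
    rw [length_firstBits, ← floor_bits S c n x0] at this
    have a1 := Nat.lt_floor_add_one (2 ^ n * (S + c))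
    have a2 := (abs_le.1 (hm k n)).2
    have a3 : ((⌊2 ^ n * (S + c)⌋₊ : ℕ) : ℝ) ≤ m (k, n) + 4 := by exact_mod_cast this
    rw [mul_sub]; linarith
  let G : List Bool →. List Bool := fun s => (F s).map (fun k => yrec out (k + k0))
  have Gex : ∀ n p, firstBits S n ∈ U.f p → ∃ k, k ∈ F (firstBits S n) ∧ yrec out (k + k0) ∈ (U.f p).bind G := by
    intro n p hp
    obtain ⟨k, hk⟩ := Fex n
    exact ⟨k, hk, Part.mem_bind_iff.2 ⟨_, hp, (Part.mem_map_iff _).2 ⟨k, hk, rfl⟩⟩⟩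
  let C : Computer := ⟨fun p => (U.f p).bind G, U.partrec.bind (pG.comp Computable.snd).to₂, by
      obtain ⟨p, hp, _⟩ := exists_prog hU (firstBits S 0)
      obtain ⟨k, _, hk⟩ := Gex 0 p hp
      exact ⟨p, Part.dom_iff_mem.2 ⟨_, hk⟩⟩, by
      intro p hp q hq h
      exact U.dom_prefixFree p (Part.bind_dom.1 hp).1 q (Part.bind_dom.1 hq).1 h⟩
  obtain ⟨d, hd⟩ := hV C
  have main : ∀ n, ∃ l : ℕ, 1 ≤ l ∧ l ≤ complexity U (firstBits S n) + d ∧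
      (l : ℝ) * (2:ℝ) ^ (-(l : ℝ) / T) ≤ (6 / c1) * 2 ^ (-(n:ℝ)) := by
    intro n
    obtain ⟨p, hp, hpl⟩ := exists_prog hU (firstBits S n)
    obtain ⟨k, hk, hy⟩ := Gex n p hp
    obtain ⟨q, hq, hql⟩ := hd p (Part.dom_iff_mem.2 ⟨_, hy⟩)
    have hy' : yrec out (k + k0) ∈ V.f q := by rw [hq]; exact hy
    obtain ⟨i, ha, hb, hi⟩ := e2 q _ hy'
    have hik : k + k0 ≤ i := by
      by_contra hlt
      have := yrec_len out (k + k0) i (not_le.1 hlt)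
      rw [hi] at this; omega
    obtain ⟨k', rfl⟩ : ∃ k', i = k' + k0 := ⟨i - k0, by omega⟩
    refine ⟨q.length, ?_, by omega, ?_⟩
    · rw [← hb]; exact hl k' ha
    · have h1 := hs k'
      rw [if_pos ha, hb, boltzmann] at h1
      have h2 := le (k' + 1)
      have h3 := mono (show k ≤ k' by omega)
      have h4 := Fq n k hk
      have p2 : (0:ℝ) < 2 ^ n := by positivity
      rw [Real.rpow_neg (by norm_num), Real.rpow_natCast]
      rw [← div_eq_mul_inv, div_div, le_div_iff₀ (by positivity)]
      calc (q.length : ℝ) * 2 ^ (-(q.length:ℝ) / T) * (c1 * 2 ^ n)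
          = 2 ^ n * (c1 * ((q.length : ℝ) * 2 ^ (-(q.length:ℝ) / T))) := by ring
        _ ≤ 2 ^ n * (S + c - X k) := by gcongr; linarith
        _ ≤ 6 := h4
  choose l l1 l2 l3 using main
  have := real_growth h0 (by positivity) l l1 l3
  refine tendsto_atTop_mono (f := fun n : ℕ => ((l n : ℝ) - T * n) + (-d)) (fun n => ?_)
    (tendsto_atTop_add_const_right _ _ this)
  have : (l n : ℝ) ≤ complexity U (firstBits S n) + d := by exact_mod_cast l2 n
  linarith

end EPR

namespace EPR

/-- number of header bits -/
def rl (x : ℕ) : ℕ := Nat.findGreatest (fun r => 2 ^ r ≤ x + 1) (x + 1) + 1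

theorem c_rl : Computable rl := by
  unfold rl
  exact c_succ (c_findGreatest (p := fun x r => 2 ^ r ≤ x + 1) (f := fun x : ℕ => x + 1) (by fun_prop) (by fun_prop))

theorem lt_rl (x : ℕ) : x < 2 ^ rl x := by
  by_contra h
  have h' : 2 ^ rl x ≤ x + 1 := by omega
  have h1 : rl x ≤ x + 1 := by
    have := Nat.lt_two_pow_self (n := rl x); omega
  have := Nat.le_findGreatest (P := fun r => 2 ^ r ≤ x + 1) h1 h'
  change _ ≤ rl x - 1 at this
  have : 1 ≤ rl x := by unfold rl; omega
  omega

theorem rl_le (x : ℕ) : 2 ^ rl x ≤ 2 * (x + 1) := by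
  have := Nat.findGreatest_spec (P := fun r => 2 ^ r ≤ x + 1) (n := x + 1) (m := 0) (by omega) (by simp)
  rw [rl, pow_succ]; beta_reduce at this; omega

theorem replicate_pfx {r r' : ℕ} {a a' : List Bool}
    (h : List.replicate r true ++ false :: a <+: List.replicate r' true ++ false :: a') : r = r' ∧ a <+: a' := by
  induction r generalizing r' with
  | zero =>
    cases r' with
    | zero => simpa using h
    | succ r' => simp [List.replicate_succ] at h
  | succ r ih =>
    cases r' with
    | zero => simp [List.replicate_succ] at h
    | succ r' =>
      simp only [List.replicate_succ, List.cons_append, List.cons_prefix_cons, true_and] at h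
      have := ih h
      exact ⟨by omega, this.2⟩

/-- self-delimiting code of a pair `(n, u)`. -/
def encd (B : ℕ × ℕ → List Bool) (x : ℕ × List Bool) : List Bool :=
  List.replicate (rl (Nat.pair x.1 x.2.length)) true ++
    false :: (B (rl (Nat.pair x.1 x.2.length), Nat.pair x.1 x.2.length) ++ x.2)

theorem c_replicate : Computable (fun r : ℕ => List.replicate r true) := by
  have : (fun r : ℕ => List.replicate r true) =
      fun r : ℕ => Nat.rec (motive := fun _ => List Bool) [] (fun _ s => true :: s) r := by
    funext r
    induction r with
    | zero => rfl
    | succ r ih => rw [List.replicate_succ, ih]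
  rw [this]
  exact c_natrec (f := fun r : ℕ => r) (g := fun _ => []) (h := fun _ _ s => true :: s) c_id (c_const _)
    (Computable.list_cons.comp (c_const _) (Computable.snd.comp Computable.snd))

theorem c_encd {B : ℕ × ℕ → List Bool} (hB : Computable B) : Computable (encd B) := by
  have h1 : Computable (fun x : ℕ × List Bool => Nat.pair x.1 x.2.length) := by fun_prop
  have h2 : Computable (fun x : ℕ × List Bool => rl (Nat.pair x.1 x.2.length)) := c_rl.comp h1
  exact Computable.list_append.comp (c_replicate.comp h2)
    (Computable.list_cons.comp (c_const _) (Computable.list_append.comp (hB.comp (h2.pair h1)) Computable.snd))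

theorem encd_pfx {B : ℕ × ℕ → List Bool} (hB : ∀ z, (B z).length = z.1 ∧ val (B z) = z.2 % 2 ^ z.1)
    {x y : ℕ × List Bool} (h : encd B x <+: encd B y) : x = y := by
  obtain ⟨h1, h2⟩ := replicate_pfx h
  have hlen : (B (rl (Nat.pair x.1 x.2.length), Nat.pair x.1 x.2.length)).length =
    (B (rl (Nat.pair y.1 y.2.length), Nat.pair y.1 y.2.length)).length := by rw [(hB _).1, (hB _).1]; exact h1
  have h3 : B (rl (Nat.pair x.1 x.2.length), Nat.pair x.1 x.2.length) =
    B (rl (Nat.pair y.1 y.2.length), Nat.pair y.1 y.2.length) := by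
    have a := (List.prefix_append (B (rl (Nat.pair x.1 x.2.length), Nat.pair x.1 x.2.length)) x.2).trans h2
    have b := List.prefix_append (B (rl (Nat.pair y.1 y.2.length), Nat.pair y.1 y.2.length)) y.2
    exact (List.prefix_of_prefix_length_le a b hlen.le).eq_of_length hlen
  rw [h3, List.prefix_append_right_inj] at h2
  have h4 := congrArg val h3
  rw [(hB _).2, (hB _).2] at h4
  dsimp only at h4
  rw [Nat.mod_eq_of_lt (lt_rl _), Nat.mod_eq_of_lt (lt_rl _), Nat.pair_eq_pair] at h4
  exact Prod.ext h4.1 (h2.eq_of_length h4.2)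

theorem encd_len {B : ℕ × ℕ → List Bool} (hB : ∀ z, (B z).length = z.1 ∧ val (B z) = z.2 % 2 ^ z.1)
    (n : ℕ) (u : List Bool) : (encd B (n, u)).length = 2 * rl (Nat.pair n u.length) + 1 + u.length := by
  simp only [encd, List.length_append, List.length_replicate, List.length_cons, (hB _).1]; omega

theorem describe {U : Computer} (hU : Optimal U) {M : ℕ × ℕ →. List Bool} (hM : Partrec M)
    (hne : ∃ z y, y ∈ M z) : ∃ d, ∀ n v w y, v < 2 ^ w → y ∈ M (n, v) →
      complexity U y ≤ 2 * rl (Nat.pair n w) + 1 + w + d := by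
  obtain ⟨B, cB, hB⟩ := exists_bits
  let dec : ℕ → ℕ × List Bool := fun e => (Encodable.decode e).getD (0, [])
  have cdec : Computable dec := Computable.option_getD Computable.decode (Computable.const _)
  have hdec : ∀ x, dec (Encodable.encode x) = x := fun x => by
    simp only [dec]; rw [Encodable.encodek]; rfl
  generalize dec = dec at cdec hdec
  have ce := c_encd cB
  obtain ⟨F, pF, F1, F2⟩ := p_search (α := List Bool) (R := fun z => decide (encd B (dec z.2) = z.1))
    (c_deq (ce.comp (cdec.comp Computable.snd)) Computable.fst)
  have F1' : ∀ p e, e ∈ F p → encd B (dec e) = p := fun p e h => of_decide_eq_true (F1 p e h)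
  have F2' : ∀ x, ∃ e, e ∈ F (encd B x) ∧ dec e = x := by
    intro x
    obtain ⟨e, he⟩ := F2 (encd B x) (Encodable.encode x) (decide_eq_true (by rw [hdec]))
    refine ⟨e, he, encd_pfx hB ?_⟩
    rw [F1' _ _ he]
  have run : ∀ n v w y, v < 2 ^ w → y ∈ M (n, v) →
      ∃ p, p.length = 2 * rl (Nat.pair n w) + 1 + w ∧ y ∈ (F p).bind (fun e => M ((dec e).1, val (dec e).2)) := by
    intro n v w y hv hy
    obtain ⟨u, hu1, hu2⟩ := val_surj w v hv
    obtain ⟨e, he, hde⟩ := F2' (n, u)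
    refine ⟨encd B (n, u), by rw [encd_len hB, hu1], Part.mem_bind_iff.2 ⟨e, he, ?_⟩⟩
    rw [hde, hu2]; exact hy
  let C : Computer := ⟨fun p => (F p).bind (fun e => M ((dec e).1, val (dec e).2)), by
      refine pF.bind ?_
      have : Computable (fun z : List Bool × ℕ => ((dec z.2).1, val (dec z.2).2)) := by
        have h := cdec.comp (Computable.snd (α := List Bool) (β := ℕ))
        exact (Computable.fst.comp h).pair (c_val.comp (Computable.snd.comp h))
      exact (hM.comp this).to₂, by
      obtain ⟨⟨n, v⟩, y, hy⟩ := hne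
      obtain ⟨p, _, hp⟩ := run n v v y Nat.lt_two_pow_self hy
      exact ⟨p, Part.dom_iff_mem.2 ⟨_, hp⟩⟩, by
      intro p hp q hq h
      obtain ⟨e, he⟩ := Part.dom_iff_mem.1 (show (F p).Dom from Exists.fst hp)
      obtain ⟨e', he'⟩ := Part.dom_iff_mem.1 (show (F q).Dom from Exists.fst hq)
      rw [← F1' _ _ he, ← F1' _ _ he'] at h ⊢
      rw [encd_pfx hB h]⟩
  obtain ⟨d, hd⟩ := hU C
  refine ⟨d, fun n v w y hv hy => ?_⟩
  obtain ⟨p, hpl, hp⟩ := run n v w y hv hy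
  obtain ⟨q, hq, hql⟩ := hd p (Part.dom_iff_mem.2 ⟨_, hp⟩)
  have : complexity U y ≤ q.length := Nat.sInf_le ⟨q, by rw [hq]; exact hp, rfl⟩
  omega

/-- greedy compression of the increasing sequence -/
def st (m : ℕ × ℕ → ℕ) (n k : ℕ) : ℕ × ℕ :=
  Nat.rec (motive := fun _ => ℕ × ℕ) (m (0, n), 0)
    (fun k s => if s.1 + 4 ≤ m (k + 1, n) then (m (k + 1, n), s.2 + 1) else s) k

theorem c_st {m : ℕ × ℕ → ℕ} (hm : Computable m) : Computable (fun z : ℕ × ℕ => st m z.1 z.2) := by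
  unfold st
  exact c_natrec (f := fun z : ℕ × ℕ => z.2) (g := fun z => ((m (0, z.1), 0) : ℕ × ℕ))
    (h := fun z k s => if s.1 + 4 ≤ m (k + 1, z.1) then (m (k + 1, z.1), s.2 + 1) else s)
    (by fun_prop) (by fun_prop) (by fun_prop)

theorem st_succ (m : ℕ × ℕ → ℕ) (n k : ℕ) : st m n (k + 1) =
    if (st m n k).1 + 4 ≤ m (k + 1, n) then (m (k + 1, n), (st m n k).2 + 1) else st m n k := rfl

theorem st_mono (m : ℕ × ℕ → ℕ) (n k i : ℕ) : (st m n k).2 ≤ (st m n (k + i)).2 ∧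
    ((st m n (k + i)).2 = (st m n k).2 → st m n (k + i) = st m n k) := by
  induction i with
  | zero => simp
  | succ i ih =>
    rw [← add_assoc, st_succ]
    split_ifs with h
    · refine ⟨by dsimp only; omega, fun h => ?_⟩
      dsimp only at h; omega
    · exact ih

theorem st_det (m : ℕ × ℕ → ℕ) (n k k' : ℕ) (h : (st m n k).2 = (st m n k').2) : st m n k = st m n k' := by
  rcases le_total k k' with hk | hk
  · obtain ⟨i, rfl⟩ := Nat.exists_eq_add_of_le hk
    exact ((st_mono m n k i).2 h.symm).symm
  · obtain ⟨i, rfl⟩ := Nat.exists_eq_add_of_le hk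
    exact ((st_mono m n k' i).2 h)

theorem st_inv {m : ℕ × ℕ → ℕ} {X : ℕ → ℝ} (mono : Monotone X)
    (hm : ∀ k n, |(m (k, n) : ℝ) - 2 ^ n * X k| ≤ 1) {p : ℝ} (hp : 0 < p) (hp1 : p ≤ 1) (n k : ℕ) :
    ∃ j ≤ k, (st m n k).1 = m (j, n) ∧ m (k, n) < (st m n k).1 + 4 ∧
      ((st m n k).2 : ℝ) ≤ ((2:ℝ) ^ n) ^ p * ∑ i ∈ Finset.range j, (X (i + 1) - X i) ^ p := by
  have D0 : ∀ i, 0 ≤ X (i + 1) - X i := fun i => sub_nonneg.2 (mono (Nat.le_succ i))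
  have sub : ∀ j i, (X (j + i) - X j) ^ p ≤ ∑ t ∈ Finset.Ico j (j + i), (X (t + 1) - X t) ^ p := by
    intro j i
    induction i with
    | zero => simp [Real.zero_rpow hp.ne']
    | succ i ih =>
      rw [← add_assoc, Finset.sum_Ico_succ_top (by omega)]
      have e : X (j + i + 1) - X j = (X (j + i) - X j) + (X (j + i + 1) - X (j + i)) := by ring
      rw [e]
      refine (Real.rpow_add_le_add_rpow (sub_nonneg.2 (mono (by omega))) (D0 _) hp.le hp1).trans ?_
      gcongr
  induction k with
  | zero => exact ⟨0, le_rfl, rfl, by simp [st], by simp [st]⟩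
  | succ k ih =>
    obtain ⟨j, hj, h1, h2, h3⟩ := ih
    rw [st_succ]
    split_ifs with h
    · refine ⟨k + 1, le_rfl, rfl, by dsimp only; omega, ?_⟩
      obtain ⟨i, hi⟩ := Nat.exists_eq_add_of_le (show j ≤ k + 1 by omega)
      have a1 := (abs_le.1 (hm (k + 1) n)).2
      have a2 := (abs_le.1 (hm j n)).1
      rw [h1] at h
      have a3 : (m (j, n) : ℝ) + 4 ≤ m (k + 1, n) := by exact_mod_cast h
      have a4 : 1 ≤ 2 ^ n * (X (k + 1) - X j) := by rw [mul_sub]; linarith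
      have a5 : 1 ≤ ((2:ℝ) ^ n) ^ p * (X (k + 1) - X j) ^ p := by
        rw [← Real.mul_rpow (by positivity) (sub_nonneg.2 (mono (by omega)))]
        exact Real.one_le_rpow a4 hp.le
      have a6 := sub j i
      rw [← hi] at a6
      rw [← Finset.sum_range_add_sum_Ico _ (show j ≤ k + 1 by omega), mul_add]
      push_cast
      refine add_le_add h3 (a5.trans ?_)
      gcongr
    · exact ⟨j, by omega, h1, by omega, h3⟩

end EPR

namespace EPR

theorem greedy {S T : ℝ} {c : ℕ} {X : ℕ → ℝ} {m : ℕ × ℕ → ℕ} (cm : Computable m) (hT1 : T < 1)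
    (nn : ∀ k, 0 ≤ X k) (mono : Monotone X) (hm : ∀ k n, |(m (k, n) : ℝ) - 2 ^ n * X k| ≤ 1)
    (ht : Tendsto X atTop (𝓝 (S + c))) (h0 : 0 < T)
    (hsum : ∀ p, T < p → p < 1 → Summable (fun k => (X (k + 1) - X k) ^ p)) :
    ∃ (M : ℕ × ℕ →. List Bool) (v : ℕ → ℕ), Partrec M ∧ (∀ n, firstBits S n ∈ M (n, v n)) ∧
      ∀ p, T < p → p < 1 → ∃ A : ℝ, ∀ n, (v n : ℝ) ≤ A * ((2:ℝ) ^ n) ^ p := by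
  have le : ∀ k, X k ≤ S + c := fun k => mono.ge_of_tendsto ht k
  have x0 : 0 ≤ S + c := (nn 0).trans (le 0)
  have D0 : ∀ i, 0 ≤ X (i + 1) - X i := fun i => sub_nonneg.2 (mono (Nat.le_succ i))
  obtain ⟨B, cB, hB⟩ := exists_bits
  have cst := c_st cm
  -- count bound
  have cb : ∀ p, T < p → p < 1 → ∀ n k, ((st m n k).2 : ℝ) ≤
      (∑' k, (X (k + 1) - X k) ^ p) * ((2:ℝ) ^ n) ^ p := by
    intro p hp hp1 n k
    obtain ⟨j, _, _, _, h⟩ := st_inv mono hm (h0.trans hp) hp1.le n k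
    refine h.trans ?_
    rw [mul_comm]
    gcongr
    exact (hsum p hp hp1).sum_le_tsum _ (fun i _ => Real.rpow_nonneg (D0 i) _)
  -- stabilization
  have stab : ∀ n, ∃ K, ∀ k ≥ K, st m n k = st m n K := by
    intro n
    obtain ⟨p, hp, hp1⟩ := exists_between hT1
    obtain ⟨b, hb⟩ := exists_nat_ge ((∑' k, (X (k + 1) - X k) ^ p) * ((2:ℝ) ^ n) ^ p)
    have hbd : ∀ k, (st m n k).2 ≤ b := fun k => by
      have := (cb p hp hp1 n k).trans hb
      exact_mod_cast this
    have hfin : (Set.range (fun k => (st m n k).2)).Finite :=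
      (Set.finite_Iic b).subset (by rintro _ ⟨k, rfl⟩; exact hbd k)
    obtain ⟨y, ⟨K, hK⟩, hmax⟩ := hfin.exists_maximal (Set.range_nonempty _)
    refine ⟨K, fun k hk => ?_⟩
    obtain ⟨i, rfl⟩ := Nat.exists_eq_add_of_le hk
    have h1 := st_mono m n K i
    apply h1.2
    refine le_antisymm ?_ h1.1
    have := hmax (y := (st m n (K + i)).2) ⟨_, rfl⟩ (by rw [← hK]; exact h1.1)
    rw [← hK] at this; exact this
  choose K hK using stab
  have bd : ∀ n, (st m n (K n)).1 ≤ ⌊2 ^ n * (S + c)⌋₊ + 1 ∧ ⌊2 ^ n * (S + c)⌋₊ ≤ (st m n (K n)).1 + 4 := by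
    intro n
    have a1 := Nat.lt_floor_add_one (2 ^ n * (S + c))
    have a2 := Nat.floor_le (show 0 ≤ 2 ^ n * (S + c) by positivity)
    constructor
    · obtain ⟨p, hp, hp1⟩ := exists_between hT1
      obtain ⟨j, _, h, _, _⟩ := st_inv mono hm (h0.trans hp) hp1.le n (K n)
      rw [h]
      have b1 := (abs_le.1 (hm j n)).2
      have b2 : 2 ^ n * X j ≤ 2 ^ n * (S + c) := by gcongr; exact le j
      have : (m (j, n) : ℝ) < ((⌊2 ^ n * (S + c)⌋₊ + 1 + 1 : ℕ) : ℝ) := by push_cast; linarith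
      have : m (j, n) < ⌊2 ^ n * (S + c)⌋₊ + 1 + 1 := by exact_mod_cast this
      omega
    · have lim : 2 ^ n * (S + c) ≤ ((st m n (K n)).1 : ℝ) + 4 := by
        refine le_of_tendsto (ht.const_mul (2 ^ n)) (eventually_atTop.2 ⟨K n, fun k hk => ?_⟩)
        obtain ⟨p, hp, hp1⟩ := exists_between hT1
        obtain ⟨j, _, _, h, _⟩ := st_inv mono hm (h0.trans hp) hp1.le n k
        rw [hK n k hk] at h
        have b1 := (abs_le.1 (hm k n)).1
        have h' : (m (k, n) : ℝ) + 1 ≤ (st m n (K n)).1 + 4 := by exact_mod_cast h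
        linarith
      have : ((⌊2 ^ n * (S + c)⌋₊ : ℕ) : ℝ) ≤ ((st m n (K n)).1 : ℝ) + 4 := a2.trans lim
      exact_mod_cast this
  obtain ⟨F, pF, F1, F2⟩ := p_search (α := ℕ × ℕ) (R := fun z => decide ((st m z.1.1 z.2).2 = z.1.2 / 8))
    (c_deq (c_snd (cst.comp (g := fun z : (ℕ × ℕ) × ℕ => (z.1.1, z.2)) (by fun_prop))) (by fun_prop))
  have cG : Computable (fun z : (ℕ × ℕ) × ℕ => B (z.1.1, (st m z.1.1 z.2).1 + z.1.2 % 8 - 1)) := by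
    have := c_fst (cst.comp (g := fun z : (ℕ × ℕ) × ℕ => (z.1.1, z.2)) (by fun_prop))
    dsimp only at this
    generalize st m = s at this
    exact cB.comp (c_pair (by fun_prop) (c_sub (c_add this (by fun_prop)) (by fun_prop)))
  let N : ℕ → ℕ := fun n => ⌊2 ^ n * (S + c)⌋₊
  let v : ℕ → ℕ := fun n => 8 * (st m n (K n)).2 + (N n + 1 - (st m n (K n)).1)
  refine ⟨fun z => (F z).map (fun k => B (z.1, (st m z.1 k).1 + z.2 % 8 - 1)), v, pF.map cG.to₂, fun n => ?_,
    fun p hp hp1 => ?_⟩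
  · obtain ⟨b1, b2⟩ := bd n
    have v8 : v n / 8 = (st m n (K n)).2 := by simp only [v, N]; omega
    have v8' : v n % 8 = N n + 1 - (st m n (K n)).1 := by simp only [v, N]; omega
    obtain ⟨k, hk⟩ := F2 (n, v n) (K n) (decide_eq_true v8.symm)
    have hk2 := of_decide_eq_true (F1 _ _ hk)
    simp only at hk2
    rw [v8] at hk2
    have hst := st_det m n _ _ hk2
    refine (Part.mem_map_iff _).2 ⟨k, hk, ?_⟩
    dsimp only
    rw [hst, v8']
    have e : (st m n (K n)).1 + (N n + 1 - (st m n (K n)).1) - 1 = N n := by simp only [N]; omega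
    rw [e]
    apply val_inj
    · rw [(hB _).1, length_firstBits]
    · rw [(hB _).2]
      dsimp only [N]
      rw [floor_bits S c n x0, Nat.add_mul_mod_self_left, Nat.mod_eq_of_lt]
      have := val_lt (firstBits S n)
      rwa [length_firstBits] at this
  · refine ⟨8 * (∑' k, (X (k + 1) - X k) ^ p) + 8, fun n => ?_⟩
    have h1 := cb p hp hp1 n (K n)
    have h2 : v n ≤ 8 * (st m n (K n)).2 + 8 := by
      have := (bd n).2
      simp only [v, N]; omega
    have h3 : (v n : ℝ) ≤ 8 * (st m n (K n)).2 + 8 := by exact_mod_cast h2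
    have h4 : (1:ℝ) ≤ ((2:ℝ) ^ n) ^ p := Real.one_le_rpow (one_le_pow₀ (by norm_num)) (by linarith)
    rw [add_mul, mul_assoc]
    linarith

theorem asym {T : ℝ} (h0 : 0 < T) (hT1 : T < 1) {H v : ℕ → ℕ} {d : ℕ}
    (hH : ∀ n w, v n < 2 ^ w → H n ≤ 2 * rl (Nat.pair n w) + 1 + w + d)
    (hv : ∀ p, T < p → p < 1 → ∃ A : ℝ, ∀ n, (v n : ℝ) ≤ A * ((2:ℝ) ^ n) ^ p) :
    ∃ g : ℕ → ℝ, Tendsto (fun n : ℕ => g n / n) atTop (nhds 0) ∧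
    ∀ n : ℕ, 0 < n → (H n : ℝ) ≤ T * n + g n := by
  have key : ∀ ε : ℝ, 0 < ε → ∀ p, T < p → p < 1 → ∀ᶠ n : ℕ in atTop, (H n : ℝ) ≤ (p + 3 * ε) * n := by
    intro ε hε p hp hp1
    have p0 : 0 < p := h0.trans hp
    obtain ⟨A, hA⟩ := hv p hp hp1
    obtain ⟨a, ha⟩ := pow_unbounded_of_one_lt A (show (1:ℝ) < 2 by norm_num)
    have r1 : (1:ℝ) < (2:ℝ) ^ ε := Real.one_lt_rpow (by norm_num) hε
    have t1 := (tendsto_pow_const_div_const_pow_of_one_lt 2 r1).eventually_lt_const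
      (show (0:ℝ) < 1 / (2 * ((a:ℝ) + 2) ^ 2) by positivity)
    have t2 : ∀ᶠ n : ℕ in atTop, ((2 + a + d : ℕ) : ℝ) ≤ ε * n :=
      ((tendsto_natCast_atTop_atTop).const_mul_atTop hε).eventually_ge_atTop _
    filter_upwards [t1, t2, eventually_ge_atTop 1] with n h1 h2 hn
    set w := a + ⌈p * n⌉₊ with hw
    have c1 := Nat.le_ceil (p * n)
    have c2 := Nat.ceil_lt_add_one (show 0 ≤ p * n by positivity)
    have hvw : v n < 2 ^ w := by
      have : (v n : ℝ) < 2 ^ w := by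
        calc (v n : ℝ) ≤ A * ((2:ℝ) ^ n) ^ p := hA n
          _ < 2 ^ a * ((2:ℝ) ^ n) ^ p := by gcongr
          _ = 2 ^ a * (2:ℝ) ^ (p * n) := by
            rw [← Real.rpow_natCast 2 n, ← Real.rpow_mul (by norm_num), mul_comm (n:ℝ)]
          _ ≤ 2 ^ a * (2:ℝ) ^ ((⌈p * n⌉₊ : ℕ) : ℝ) := by
            gcongr; norm_num
          _ = 2 ^ w := by rw [Real.rpow_natCast, hw, pow_add]
      exact_mod_cast this
    have hwn : w ≤ n + a := by
      have : ⌈p * n⌉₊ ≤ n := Nat.ceil_le.2 (by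
        have : (0:ℝ) ≤ n := by positivity
        nlinarith)
      omega
    have hr : (rl (Nat.pair n w) : ℝ) ≤ ε * n := by
      have b1 := rl_le (Nat.pair n w)
      have b2 := Nat.pair_lt_max_add_one_sq n w
      have b3 : max n w + 1 ≤ (a + 2) * n := by
        have : max n w ≤ n + a := max_le (by omega) hwn
        nlinarith
      have b4 : 2 ^ rl (Nat.pair n w) ≤ 2 * ((a + 2) * n) ^ 2 := by
        have := Nat.pow_le_pow_left b3 2
        omega
      have b5 : (2:ℝ) ^ rl (Nat.pair n w) ≤ 2 * ((a + 2) * n) ^ 2 := by exact_mod_cast b4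
      have b6 : 2 * (((a:ℝ) + 2) * n) ^ 2 ≤ ((2:ℝ) ^ ε) ^ n := by
        rw [div_lt_div_iff₀ (by positivity) (by positivity)] at h1
        nlinarith
      have b7 := b5.trans b6
      rw [← Real.rpow_natCast, ← Real.rpow_natCast, ← Real.rpow_mul (by norm_num),
        Real.rpow_le_rpow_left_iff (by norm_num)] at b7
      exact b7
    have := hH n w hvw
    have h3 : (H n : ℝ) ≤ 2 * rl (Nat.pair n w) + 1 + w + d := by exact_mod_cast this
    have h4 : (w : ℝ) = a + (⌈p * n⌉₊ : ℕ) := by rw [hw]; push_cast; rfl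
    push_cast at h2
    nlinarith
  refine ⟨fun n => max 0 ((H n : ℝ) - T * n), ?_, fun n _ => ?_⟩
  · rw [tendsto_order]
    constructor
    · intro a ha
      refine Eventually.of_forall (fun n => lt_of_lt_of_le ha (by positivity))
    · intro a ha
      obtain ⟨p, hp, hp2⟩ := exists_between (show T < min 1 (T + a / 4) from lt_min hT1 (by linarith))
      have hp1 := lt_of_lt_of_le hp2 (min_le_left _ _)
      have hpa := lt_of_lt_of_le hp2 (min_le_right _ _)
      filter_upwards [key (a / 12) (by linarith) p hp hp1, eventually_ge_atTop 1] with n hn h1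
      have n0 : (0:ℝ) < n := by exact_mod_cast h1
      rw [div_lt_iff₀ n0]
      apply max_lt
      · positivity
      · nlinarith
  · have := le_max_right 0 ((H n : ℝ) - T * n)
    linarith

theorem sum_pow (V : Computer) {T : ℝ} (h0 : 0 < T)
    {act : ℕ → Bool} {prog out : ℕ → List Bool} {k0 : ℕ} {c2 : ℝ} {X : ℕ → ℝ}
    (e1 : ∀ i, act i = true → out i ∈ V.f (prog i))
    (e2 : ∀ q y, y ∈ V.f q → ∃ i, act i = true ∧ prog i = q ∧ out i = y)
    (e3 : ∀ i j, act i = true → act j = true → prog i = prog j → i = j)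
    (hc2 : 0 < c2) (mono : Monotone X)
    (hs : ∀ k, X (k + 1) - X k ≤
        c2 * (if act (k + k0) = true then ((prog (k + k0)).length : ℝ) * boltzmann T (prog (k + k0)) else 0))
    (p : ℝ) (hp : T < p) (hp1 : p < 1) : Summable (fun k => (X (k + 1) - X k) ^ p) := by
  have p0 : 0 < p := h0.trans hp
  set r : ℝ := (2:ℝ) ^ (-(p / T)) with hr
  have rp : 0 < r := by positivity
  have rh : r < 1/2 := by
    have : r < (2:ℝ) ^ (-1:ℝ) := by
      apply Real.rpow_lt_rpow_of_exponent_lt (by norm_num)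
      have := (one_lt_div h0).2 hp
      linarith
    rw [Real.rpow_neg_one] at this; linarith
  have s := ((summable_geo rp.le rh).2.comp_injective (Subtype.val_injective (p := fun q => q ∈ V.f.Dom))).hasSum
  have s2 := ((enum_sum V e1 e2 e3 (fun q => (q.length : ℝ) * r ^ q.length) _).2 s).summable
  have s3 := (((summable_nat_add_iff k0).2 s2).mul_left (c2 ^ p))
  have D0 : ∀ i, 0 ≤ X (i + 1) - X i := fun i => sub_nonneg.2 (mono (Nat.le_succ i))
  refine Summable.of_nonneg_of_le (fun k => Real.rpow_nonneg (D0 k) _) (fun k => ?_) s3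
  refine (Real.rpow_le_rpow (D0 k) (hs k) p0.le).trans ?_
  split_ifs with ha
  · have hb : 0 ≤ boltzmann T (prog (k + k0)) := by unfold boltzmann; positivity
    rw [Real.mul_rpow hc2.le (by positivity), Real.mul_rpow (by positivity) hb]
    have e : boltzmann T (prog (k + k0)) ^ p = r ^ (prog (k + k0)).length := by
      rw [boltzmann, hr, ← Real.rpow_mul (by norm_num), ← Real.rpow_natCast, ← Real.rpow_mul (by norm_num)]
      congr 1; ring
    rw [e]
    gcongr
    rcases Nat.eq_zero_or_pos (prog (k + k0)).length with h | h
    · rw [h]; simp [Real.zero_rpow p0.ne']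
    · exact Real.rpow_le_self_of_one_le (by exact_mod_cast h) hp1.le
  · simp [Real.zero_rpow p0.ne']

end EPR

/-- For optimal `V` and computable `T` with `0 < T < 1`, the
statistical mechanical entropy `S_V(T)` is a well-defined real that is Chaitin
`T`-random and `T`-compressible. -/
theorem entropy_partial_randomness
    (U : Computer) (hU : Optimal U) (V : Computer) (hV : Optimal V)
    (T : ℝ) (hT : T ∈ Set.Ioo (0 : ℝ) 1) (hTcomp : ComputableReal T) :
    Summable (fun p : V.f.Dom => boltzmann T p.1) ∧
    Summable (fun p : V.f.Dom => (p.1.length : ℝ) * boltzmann T p.1) ∧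
    ChaitinTRandom U T (Sfun V T) ∧ TCompressible U T (Sfun V T) := by
  obtain ⟨h0, h1⟩ := hT
  obtain ⟨s1, s2, act, prog, out, k0, c, c1, c2, X, m, ca, cp, co, cm, e1, e2, e3, hc1, hc2, nn, hm, hs1, hs2, hs3, ht⟩ :=
    EPR.setup V h0 h1 hTcomp
  refine ⟨s1, s2, EPR.partA U V hU hV h0 co cm e2 hc1 nn hm hs1 hs3 ht, ?_⟩
  have mono : Monotone X := by
    refine monotone_nat_of_le_succ (fun k => ?_)
    have := hs1 k
    have h : 0 ≤ c1 * (if act (k + k0) = true then ((prog (k + k0)).length : ℝ) * boltzmann T (prog (k + k0)) else 0) := by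
      split_ifs
      · unfold boltzmann; positivity
      · simp
    linarith
  obtain ⟨M, v, pM, hMv, hv⟩ := EPR.greedy cm h1 nn mono hm ht h0
    (EPR.sum_pow V h0 e1 e2 e3 hc2 mono hs2)
  obtain ⟨d, hd⟩ := EPR.describe hU pM ⟨_, _, hMv 0⟩
  exact EPR.asym h0 h1 (H := fun n => complexity U (firstBits (Sfun V T) n)) (fun n w hw => hd n (v n) w _ hw (hMv n)) hv
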